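/- arXiv:1606.08625 — 8 statements merged into one kernel-verified Lean document; each statement's English description precedes it below -/
import Mathlib

section
/- Let ρ > 0, μ > 0, A > 0 be real numbers, let λ ∈ ℂ with λ ∉ (−∞,0] (so in particular λ ≠ 0), let a ∈ ℝ, and let B be the principal square root of (ρ/μ)λ + A² (which has positive real part). Then the function ξ ↦ e^{iaξ} / ((A² + ξ²)(ρλ + μ(A² + ξ²))) is integrable on ℝ and (1/(2π)) ∫_ℝ e^{iaξ} / ((A² + ξ²)(ρλ + μ(A² + ξ²))) dξ = (1/(2ρλ)) ( e^{−|a|A}/A − e^{−|a|B}/B ). -/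
open MeasureTheory Complex
open scoped FourierTransform

/-- The principal square root maps the slit plane into the right half-plane. -/
theorem cpow_half_re_pos {z : ℂ} (hz : z ∈ slitPlane) : 0 < (z ^ ((1 : ℂ) / 2)).re := by
  rw [cpow_def_of_ne_zero (slitPlane_ne_zero hz), exp_re]
  have him : (log z * (1 / 2)).im = z.arg / 2 := by
    simp [mul_im, log_im, div_eq_mul_inv]
  rw [him]
  refine mul_pos (Real.exp_pos _) (Real.cos_pos_of_mem_Ioo ⟨?_, ?_⟩)
  · linarith [neg_pi_lt_arg z]
  · have := (arg_le_pi z).lt_of_ne (mem_slitPlane_iff_arg.mp hz).1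
    linarith

theorem add_I_mul_ne_zero {C : ℂ} (hC : 0 < C.re) (ξ : ℝ) : C + I * ξ ≠ 0 := by
  intro h
  have := congrArg re h
  simp at this
  exact hC.ne' this

theorem sq_add_sq_eq (C : ℂ) (ξ : ℝ) :
    C ^ 2 + (ξ : ℂ) ^ 2 = (C + I * ξ) * (C + I * (-ξ : ℝ)) := by
  push_cast
  linear_combination (ξ : ℂ) ^ 2 * I_sq

theorem sq_add_sq_ne_zero {C : ℂ} (hC : 0 < C.re) (ξ : ℝ) : C ^ 2 + (ξ : ℂ) ^ 2 ≠ 0 := by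
  rw [sq_add_sq_eq]
  exact mul_ne_zero (add_I_mul_ne_zero hC _) (add_I_mul_ne_zero hC _)

theorem one_add_sq_le_normSq (C : ℂ) (ξ : ℝ) :
    C.re ^ 2 * (1 + ξ ^ 2) ≤ (1 + normSq C) * normSq (C + I * ξ) := by
  simp only [normSq_apply, add_re, add_im, mul_re, mul_im, I_re, I_im, ofReal_re, ofReal_im]
  nlinarith [sq_nonneg (C.re ^ 2 + C.im * (ξ + C.im)), sq_nonneg (C.im + ξ)]

theorem one_add_sq_le_norm (C : ℂ) (ξ : ℝ) :
    C.re ^ 2 * (1 + ξ ^ 2) ≤ (1 + normSq C) * ‖C ^ 2 + (ξ : ℂ) ^ 2‖ := by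
  have h1 := one_add_sq_le_normSq C ξ
  have h2 := one_add_sq_le_normSq C (-ξ)
  rw [neg_sq] at h2
  have hN : 0 ≤ 1 + normSq C := add_nonneg zero_le_one (normSq_nonneg C)
  have h := mul_le_mul h1 h2 (by positivity) (mul_nonneg hN (normSq_nonneg _))
  refine le_of_sq_le_sq ?_ (mul_nonneg hN (norm_nonneg _))
  rw [mul_pow (1 + normSq C), ← normSq_eq_norm_sq, sq_add_sq_eq, normSq_mul]
  linarith

theorem integrable_inv_sq_add_sq {C : ℂ} (hC : 0 < C.re) :
    Integrable fun ξ : ℝ => (C ^ 2 + (ξ : ℂ) ^ 2)⁻¹ := by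
  refine (integrable_inv_one_add_sq.const_mul ((1 + normSq C) / C.re ^ 2)).mono' ?_ ?_
  · exact (Continuous.inv₀ (by fun_prop) (sq_add_sq_ne_zero hC)).aestronglyMeasurable
  · refine .of_forall fun ξ => ?_
    have h := one_add_sq_le_norm C ξ
    have h0 : 0 < ‖C ^ 2 + (ξ : ℂ) ^ 2‖ := norm_pos_iff.mpr (sq_add_sq_ne_zero hC ξ)
    rw [norm_inv, ← div_eq_mul_inv, div_div, inv_eq_one_div,
      div_le_div_iff₀ h0 (by positivity)]
    linarith

theorem integrable_exp_div_sq_add_sq {C : ℂ} (hC : 0 < C.re) (a : ℝ) :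
    Integrable fun ξ : ℝ => exp (I * a * ξ) / (C ^ 2 + (ξ : ℂ) ^ 2) := by
  simp_rw [div_eq_mul_inv]
  refine (integrable_inv_sq_add_sq hC).bdd_mul (c := 1)
    (Continuous.aestronglyMeasurable (by fun_prop)) (.of_forall fun ξ => ?_)
  simp [norm_exp]

theorem eqOn_exp_mul_abs_Ioi (C s : ℂ) :
    Set.EqOn (fun x : ℝ => exp (s * x) * exp (-C * (|x| : ℝ)))
      (fun x : ℝ => exp ((s - C) * x)) (Set.Ioi 0) := fun x hx => by
  simp only [abs_of_pos hx.out, ← exp_add]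
  ring_nf

theorem eqOn_exp_mul_abs_Iic (C s : ℂ) :
    Set.EqOn (fun x : ℝ => exp (s * x) * exp (-C * (|x| : ℝ)))
      (fun x : ℝ => exp ((s + C) * x)) (Set.Iic 0) := fun x hx => by
  simp only [abs_of_nonpos hx.out, ← exp_add]
  push_cast
  ring_nf

theorem integrableOn_exp_mul_abs {C s : ℂ} (hC : 0 < C.re) (hs : s.re = 0) :
    IntegrableOn (fun x : ℝ => exp (s * x) * exp (-C * (|x| : ℝ))) (Set.Iic 0) ∧
      IntegrableOn (fun x : ℝ => exp (s * x) * exp (-C * (|x| : ℝ))) (Set.Ioi 0) :=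
  ⟨(integrableOn_exp_mul_complex_Iic (by simpa [hs] using hC) 0).congr_fun
      (eqOn_exp_mul_abs_Iic C s).symm measurableSet_Iic,
    (integrableOn_exp_mul_complex_Ioi (by simpa [hs] using hC) 0).congr_fun
      (eqOn_exp_mul_abs_Ioi C s).symm measurableSet_Ioi⟩

theorem integral_exp_mul_abs {C s : ℂ} (hC : 0 < C.re) (hs : s.re = 0) :
    ∫ x : ℝ, exp (s * x) * exp (-C * (|x| : ℝ)) = 2 * C / (C ^ 2 - s ^ 2) := by
  obtain ⟨h1, h2⟩ := integrableOn_exp_mul_abs hC hs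
  rw [← intervalIntegral.integral_Iic_add_Ioi h1 h2,
    setIntegral_congr_fun measurableSet_Iic (eqOn_exp_mul_abs_Iic C s),
    setIntegral_congr_fun measurableSet_Ioi (eqOn_exp_mul_abs_Ioi C s),
    integral_exp_mul_complex_Iic (by simpa [hs] using hC),
    integral_exp_mul_complex_Ioi (by simpa [hs] using hC)]
  have e1 : s + C ≠ 0 := fun h => by
    have := congrArg re h
    simp [hs] at this
    exact hC.ne' this
  have e2 : s - C ≠ 0 := fun h => by
    have := congrArg re h
    simp [hs] at this
    exact hC.ne' this
  have e3 : C ^ 2 - s ^ 2 ≠ 0 := by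
    rw [show C ^ 2 - s ^ 2 = -((s + C) * (s - C)) by ring]
    exact neg_ne_zero.mpr (mul_ne_zero e1 e2)
  simp only [ofReal_zero, mul_zero, exp_zero]
  field_simp
  ring

theorem fourier_exp_neg_mul_abs {C : ℂ} (hC : 0 < C.re) :
    𝓕 (fun x : ℝ => exp (-C * (|x| : ℝ))) =
      fun w : ℝ => 2 * C * (C ^ 2 + ((2 * Real.pi * w : ℝ) : ℂ) ^ 2)⁻¹ := by
  ext w
  rw [Real.fourier_real_eq_integral_exp_smul]
  have h := integral_exp_mul_abs (s := -(2 * Real.pi * w : ℝ) * I) hC (by simp)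
  rw [mul_pow, I_sq, neg_sq, mul_neg_one, sub_neg_eq_add] at h
  rw [← div_eq_mul_inv, ← h]
  congr 1
  ext x
  rw [smul_eq_mul]
  congr 2
  push_cast
  ring

/-- The Fourier integral of `ξ ↦ 1 / (C² + ξ²)` for `C` in the right half-plane. -/
theorem integral_exp_div_sq_add_sq {C : ℂ} (hC : 0 < C.re) (a : ℝ) :
    ∫ ξ : ℝ, exp (I * a * ξ) / (C ^ 2 + (ξ : ℂ) ^ 2) =
      Real.pi * (exp (-(|a| : ℝ) * C) / C) := by
  have hC0 : C ≠ 0 := fun h => by simp [h] at hC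
  have hf : Integrable fun x : ℝ => exp (-C * (|x| : ℝ)) := by
    obtain ⟨h1, h2⟩ := integrableOn_exp_mul_abs (s := 0) hC rfl
    have := h1.union h2
    rw [Set.Iic_union_Ioi, integrableOn_univ] at this
    simpa using this
  have hFf : Integrable (𝓕 fun x : ℝ => exp (-C * (|x| : ℝ))) := by
    rw [fourier_exp_neg_mul_abs hC]
    exact ((integrable_inv_sq_add_sq hC).comp_mul_left' (by positivity)).const_mul _
  have hinv := congrFun (Continuous.fourierInv_fourier_eq (by fun_prop) hf hFf) a
  rw [Real.fourierInv_eq', fourier_exp_neg_mul_abs hC] at hinv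
  have hsub := Measure.integral_comp_mul_left
    (fun ξ : ℝ => exp (I * a * ξ) / (C ^ 2 + (ξ : ℂ) ^ 2)) (2 * Real.pi)
  have hpi : (Real.pi : ℂ) ≠ 0 := ofReal_ne_zero.mpr Real.pi_ne_zero
  have hkey : 2 * C * ∫ w : ℝ, exp (I * a * (2 * Real.pi * w : ℝ)) /
      (C ^ 2 + ((2 * Real.pi * w : ℝ) : ℂ) ^ 2) = exp (-C * (|a| : ℝ)) := by
    rw [← hinv, ← integral_const_mul]
    congr 1
    ext w
    rw [smul_eq_mul, div_eq_mul_inv, mul_left_comm]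
    congr 2
    simp
    ring
  rw [hsub, abs_of_pos (by positivity), real_smul] at hkey
  rw [show -((|a| : ℝ) : ℂ) * C = -C * (|a| : ℝ) by ring, ← hkey]
  push_cast
  field_simp

/-- for real `ρ, μ, A > 0`, `λ ∈ ℂ ∖ (−∞,0]`, `a ∈ ℝ`, and `B` the principal
square root of `(ρ/μ)λ + A²`, the function
`ξ ↦ e^{iaξ} / ((A² + ξ²)(ρλ + μ(A² + ξ²)))` is integrable on `ℝ` and
`(1/(2π)) ∫_ℝ e^{iaξ}/((A²+ξ²)(ρλ+μ(A²+ξ²))) dξ = (1/(2ρλ))(e^{−|a|A}/A − e^{−|a|B}/B)`. -/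
theorem statement6 (ρ μ A : ℝ) (hρ : 0 < ρ) (hμ : 0 < μ) (hA : 0 < A)
    (l : ℂ) (hl : ∀ x : ℝ, x ≤ 0 → l ≠ (x : ℂ)) (a : ℝ)
    (B : ℂ) (hB : B = (((ρ / μ : ℝ) : ℂ) * l + ((A : ℂ)) ^ 2) ^ ((1 : ℂ)/2)) :
    Integrable (fun ξ : ℝ =>
      Complex.exp (Complex.I * (a : ℂ) * (ξ : ℂ)) /
        (((A : ℂ) ^ 2 + (ξ : ℂ) ^ 2) *
          ((ρ : ℂ) * l + (μ : ℂ) * ((A : ℂ) ^ 2 + (ξ : ℂ) ^ 2)))) ∧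
    (1 / (2 * (Real.pi : ℂ))) *
        ∫ ξ : ℝ, Complex.exp (Complex.I * (a : ℂ) * (ξ : ℂ)) /
          (((A : ℂ) ^ 2 + (ξ : ℂ) ^ 2) *
            ((ρ : ℂ) * l + (μ : ℂ) * ((A : ℂ) ^ 2 + (ξ : ℂ) ^ 2)))
      = (1 / (2 * (ρ : ℂ) * l)) *
          (Complex.exp (-((|a| * A : ℝ) : ℂ)) / (A : ℂ)
            - Complex.exp (-((|a| : ℝ) : ℂ) * B) / B) := by
  have hρ0 : (ρ : ℂ) ≠ 0 := ofReal_ne_zero.mpr hρ.ne'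
  have hμ0 : (μ : ℂ) ≠ 0 := ofReal_ne_zero.mpr hμ.ne'
  have hA0 : (A : ℂ) ≠ 0 := ofReal_ne_zero.mpr hA.ne'
  have hl0 : l ≠ 0 := by simpa using hl 0 le_rfl
  have hAre : 0 < (A : ℂ).re := by simpa using hA
  have hslit : ((ρ / μ : ℝ) : ℂ) * l + (A : ℂ) ^ 2 ∈ slitPlane := by
    have hlm : l ∈ slitPlane := by
      rw [mem_slitPlane_iff]
      by_contra! h
      exact hl l.re h.1 (Complex.ext rfl (by simpa using h.2))
    have hc : 0 < ρ / μ := div_pos hρ hμ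
    rw [mem_slitPlane_iff] at hlm ⊢
    rw [← ofReal_pow, add_re, add_im, re_ofReal_mul, im_ofReal_mul, ofReal_re, ofReal_im, add_zero]
    rcases hlm with h | h
    · left
      positivity
    · right
      exact mul_ne_zero hc.ne' h
  have hBre : 0 < B.re := hB ▸ cpow_half_re_pos hslit
  have hB0 : B ≠ 0 := fun h => by simp [h] at hBre
  have hBsq : (μ : ℂ) * B ^ 2 = ρ * l + μ * (A : ℂ) ^ 2 := by
    rw [hB, one_div, cpow_ofNat_inv_pow]
    push_cast
    field_simp
  have hfun : (fun ξ : ℝ => exp (I * (a : ℂ) * (ξ : ℂ)) / (((A : ℂ) ^ 2 + (ξ : ℂ) ^ 2) *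
      ((ρ : ℂ) * l + (μ : ℂ) * ((A : ℂ) ^ 2 + (ξ : ℂ) ^ 2)))) =
      fun ξ : ℝ => 1 / (ρ * l) * (exp (I * a * ξ) / ((A : ℂ) ^ 2 + (ξ : ℂ) ^ 2) -
        exp (I * a * ξ) / (B ^ 2 + (ξ : ℂ) ^ 2)) := by
    ext ξ
    have h1 := sq_add_sq_ne_zero hAre ξ
    have h2 := sq_add_sq_ne_zero hBre ξ
    rw [show (ρ : ℂ) * l + μ * ((A : ℂ) ^ 2 + (ξ : ℂ) ^ 2) = μ * (B ^ 2 + (ξ : ℂ) ^ 2) by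
      linear_combination -hBsq]
    field_simp
    linear_combination -hBsq
  have hiA := integrable_exp_div_sq_add_sq hAre a
  have hiB := integrable_exp_div_sq_add_sq hBre a
  rw [hfun]
  refine ⟨(hiA.sub hiB).const_mul _, ?_⟩
  rw [integral_const_mul, integral_sub hiA hiB, integral_exp_div_sq_add_sq hAre,
    integral_exp_div_sq_add_sq hBre]
  have hpi : (Real.pi : ℂ) ≠ 0 := ofReal_ne_zero.mpr Real.pi_ne_zero
  rw [ofReal_mul, ← neg_mul]
  field_simp
end

section
/- Let A > 0 be a real number and a ∈ ℝ with a ≠ 0. Then the symmetric improper integral (1/(2π)) ∫_{−R}^{R} iξ e^{iaξ} / (A² + ξ²) dξ converges as R → ∞ and lim_{R→∞} (1/(2π)) ∫_{−R}^{R} iξ e^{iaξ} / (A² + ξ²) dξ = −sign(a) · e^{−|a|A} / 2, where sign(a) = 1 for a > 0 and sign(a) = −1 for a < 0. -/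
open MeasureTheory Complex Filter

/-- The one-sided profile `x ↦ x e^{-cx}` on `(0, ∞)`, extended by zero. -/
noncomputable def mulExpIoi (c : ℂ) : ℝ → ℂ :=
  (Set.Ioi (0 : ℝ)).indicator fun x => (x : ℂ) * cexp (-(c * x))

lemma integrableOn_mul_cexp_neg_mul_Ioi {c : ℂ} (hc : 0 < c.re) :
    IntegrableOn (fun x : ℝ => (x : ℂ) * cexp (-(c * x))) (Set.Ioi 0) := by
  have h := integrableOn_rpow_mul_exp_neg_mul_rpow (p := 1) (s := 1) (by norm_num)
    (by norm_num) hc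
  refine h.mono' (by fun_prop) ?_
  filter_upwards [ae_restrict_mem measurableSet_Ioi] with x hx
  have hx' : (0 : ℝ) < x := hx
  simp [Complex.norm_exp, abs_of_pos hx']

lemma integrable_mulExpIoi {c : ℂ} (hc : 0 < c.re) : Integrable (mulExpIoi c) :=
  (integrable_indicator_iff measurableSet_Ioi).2 (integrableOn_mul_cexp_neg_mul_Ioi hc)

lemma tendsto_ofReal_mul_cexp_neg_mul {c : ℂ} (hc : 0 < c.re) :
    Tendsto (fun x : ℝ => (x : ℂ) * cexp (-(c * x))) atTop (nhds 0) := by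
  rw [tendsto_zero_iff_norm_tendsto_zero]
  have h := tendsto_rpow_mul_exp_neg_mul_atTop_nhds_zero 1 c.re hc
  refine h.congr' ?_
  filter_upwards [eventually_gt_atTop 0] with x hx
  simp [Complex.norm_exp, abs_of_pos hx]

lemma tendsto_cexp_neg_mul {c : ℂ} (hc : 0 < c.re) :
    Tendsto (fun x : ℝ => cexp (-(c * x))) atTop (nhds 0) := by
  rw [tendsto_zero_iff_norm_tendsto_zero]
  have h := tendsto_rpow_mul_exp_neg_mul_atTop_nhds_zero 0 c.re hc
  refine h.congr fun x => ?_
  simp [Complex.norm_exp]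

lemma integral_mulExpIoi {c : ℂ} (hc : 0 < c.re) : ∫ x, mulExpIoi c x = 1 / c ^ 2 := by
  have hc0 : c ≠ 0 := by rintro rfl; simp at hc
  unfold mulExpIoi
  rw [integral_indicator measurableSet_Ioi]
  have hd : ∀ x ∈ Set.Ici (0 : ℝ), HasDerivAt
      (fun x : ℝ => -(1 / c) * ((x : ℂ) * cexp (-(c * x))) - 1 / c ^ 2 * cexp (-(c * x)))
      ((x : ℂ) * cexp (-(c * x))) x := by
    intro x _
    have h1 : HasDerivAt (fun x : ℝ => (x : ℂ)) 1 x := ofRealCLM.hasDerivAt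
    have h2 : HasDerivAt (fun x : ℝ => cexp (-(c * x))) (cexp (-(c * x)) * -(c * 1)) x :=
      (h1.const_mul c).neg.cexp
    refine (((h1.mul h2).const_mul (-(1 / c))).sub (h2.const_mul (1 / c ^ 2))).congr_deriv ?_
    field_simp
    ring
  have ht := ((tendsto_ofReal_mul_cexp_neg_mul hc).const_mul (-(1 / c))).sub
    ((tendsto_cexp_neg_mul hc).const_mul (1 / c ^ 2))
  rw [integral_Ioi_of_hasDerivAt_of_tendsto' hd (integrableOn_mul_cexp_neg_mul_Ioi hc) ht]
  simp

/-- The even function `x ↦ |x| e^{-A|x|}`. -/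
noncomputable def absMulExp (A : ℝ) (x : ℝ) : ℂ := ((|x| * Real.exp (-(A * |x|)) : ℝ) : ℂ)

lemma cexp_mul_absMulExp (A t x : ℝ) :
    cexp (-(t * x) * I) * absMulExp A x =
      mulExpIoi (A + t * I) x + mulExpIoi (A - t * I) (-x) := by
  unfold mulExpIoi absMulExp
  rcases lt_trichotomy x 0 with hx | rfl | hx
  · rw [Set.indicator_of_notMem (by simpa using hx.le),
      Set.indicator_of_mem (by simpa using hx), abs_of_neg hx]
    push_cast
    rw [mul_left_comm, ← Complex.exp_add]
    ring_nf
  · simp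
  · rw [Set.indicator_of_mem (by simpa using hx),
      Set.indicator_of_notMem (by simpa using hx.le), abs_of_pos hx]
    push_cast
    rw [mul_left_comm, ← Complex.exp_add]
    ring_nf

lemma continuous_absMulExp (A : ℝ) : Continuous (absMulExp A) := by
  unfold absMulExp
  fun_prop

lemma integrable_absMulExp {A : ℝ} (hA : 0 < A) : Integrable (absMulExp A) := by
  have h : Integrable (mulExpIoi A) := integrable_mulExpIoi (by simpa using hA)
  refine (h.add h.comp_neg).congr (ae_of_all _ fun x => ?_)
  simpa using (cexp_mul_absMulExp A 0 x).symm

/-- The derivative of `ξ ↦ ξ / (A² + ξ²)`. -/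
noncomputable def divSqAddSqDeriv (A ξ : ℝ) : ℂ :=
  ((A : ℂ) ^ 2 - (ξ : ℂ) ^ 2) / ((A : ℂ) ^ 2 + (ξ : ℂ) ^ 2) ^ 2

lemma ofReal_sq_add_ofReal_sq_ne_zero {A : ℝ} (hA : 0 < A) (ξ : ℝ) :
    (A : ℂ) ^ 2 + (ξ : ℂ) ^ 2 ≠ 0 := by
  have h : A ^ 2 + ξ ^ 2 ≠ 0 := by positivity
  exact_mod_cast h

lemma continuous_divSqAddSqDeriv {A : ℝ} (hA : 0 < A) : Continuous (divSqAddSqDeriv A) := by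
  unfold divSqAddSqDeriv
  exact Continuous.div (by fun_prop) (by fun_prop)
    fun ξ => pow_ne_zero 2 (ofReal_sq_add_ofReal_sq_ne_zero hA ξ)

lemma integrable_divSqAddSqDeriv {A : ℝ} (hA : 0 < A) : Integrable (divSqAddSqDeriv A) := by
  refine (integrable_inv_one_add_sq.const_mul (1 + 1 / A ^ 2)).mono'
    (continuous_divSqAddSqDeriv hA).aestronglyMeasurable (ae_of_all _ fun ξ => ?_)
  have hpos : 0 < A ^ 2 + ξ ^ 2 := by positivity
  have hnorm : ‖divSqAddSqDeriv A ξ‖ = |A ^ 2 - ξ ^ 2| / (A ^ 2 + ξ ^ 2) ^ 2 := by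
    have : divSqAddSqDeriv A ξ = (((A ^ 2 - ξ ^ 2) / (A ^ 2 + ξ ^ 2) ^ 2 : ℝ) : ℂ) := by
      simp [divSqAddSqDeriv]
    rw [this, Complex.norm_real, Real.norm_eq_abs, abs_div, abs_of_pos (pow_pos hpos 2)]
  have habs : |A ^ 2 - ξ ^ 2| ≤ A ^ 2 + ξ ^ 2 :=
    abs_le.2 ⟨by nlinarith [sq_nonneg A], by nlinarith [sq_nonneg ξ]⟩
  calc ‖divSqAddSqDeriv A ξ‖ ≤ (A ^ 2 + ξ ^ 2) / (A ^ 2 + ξ ^ 2) ^ 2 := by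
        rw [hnorm]; gcongr
    _ = 1 / (A ^ 2 + ξ ^ 2) := by field_simp
    _ ≤ (1 + 1 / A ^ 2) * (1 + ξ ^ 2)⁻¹ := by
        rw [← div_eq_mul_inv, div_le_div_iff₀ hpos (by positivity)]
        have h : (1 + 1 / A ^ 2) * (A ^ 2 + ξ ^ 2) = 1 * (1 + ξ ^ 2) + (A ^ 2 + ξ ^ 2 / A ^ 2) := by
          field_simp
          ring
        rw [h]
        have : 0 ≤ A ^ 2 + ξ ^ 2 / A ^ 2 := by positivity
        linarith

open scoped FourierTransform

lemma fourier_absMulExp {A : ℝ} (hA : 0 < A) (w : ℝ) :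
    𝓕 (absMulExp A) w = 2 * divSqAddSqDeriv A (2 * Real.pi * w) := by
  set t : ℝ := 2 * Real.pi * w with ht
  have h1 : 0 < ((A : ℂ) + t * I).re := by simpa using hA
  have h2 : 0 < ((A : ℂ) - t * I).re := by simpa using hA
  have key : ∀ v : ℝ, cexp (↑(-2 * Real.pi * v * w) * I) • absMulExp A v =
      mulExpIoi (A + t * I) v + mulExpIoi (A - t * I) (-v) := by
    intro v
    rw [← cexp_mul_absMulExp, smul_eq_mul, ht]
    push_cast
    ring_nf
  rw [Real.fourier_real_eq_integral_exp_smul]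
  simp_rw [key]
  rw [integral_add (integrable_mulExpIoi h1) (integrable_mulExpIoi h2).comp_neg,
    integral_neg_eq_self, integral_mulExpIoi h1, integral_mulExpIoi h2, divSqAddSqDeriv]
  have n1 : (A : ℂ) + t * I ≠ 0 := by intro h; simp [h] at h1
  have n2 : (A : ℂ) - t * I ≠ 0 := by intro h; simp [h] at h2
  have hprod : (A : ℂ) ^ 2 + (t : ℂ) ^ 2 = (A + t * I) * (A - t * I) := by
    linear_combination (t : ℂ) ^ 2 * I_sq
  rw [hprod]
  field_simp
  linear_combination 2 * (t : ℂ) ^ 2 * I_sq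

lemma integral_divSqAddSqDeriv_mul_cexp {A : ℝ} (hA : 0 < A) (a : ℝ) :
    ∫ ξ : ℝ, divSqAddSqDeriv A ξ * cexp (I * a * ξ) =
      Real.pi * (|a| * Real.exp (-(A * |a|)) : ℝ) := by
  have hpi : (2 * Real.pi : ℝ) ≠ 0 := by positivity
  have hF : 𝓕 (absMulExp A) = fun w => 2 * divSqAddSqDeriv A (2 * Real.pi * w) :=
    funext (fourier_absMulExp hA)
  have hint : Integrable (𝓕 (absMulExp A)) := by
    rw [hF]
    exact ((integrable_divSqAddSqDeriv hA).comp_mul_left' hpi).const_mul 2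
  have hinv := congrFun ((continuous_absMulExp A).fourierInv_fourier_eq
    (integrable_absMulExp hA) hint) a
  rw [Real.fourierInv_eq', hF] at hinv
  have hsubst := Measure.integral_comp_mul_left
    (fun ξ : ℝ => 2 * (divSqAddSqDeriv A ξ * cexp (I * a * ξ))) (2 * Real.pi)
  have hcongr : ∀ v : ℝ, cexp (↑(2 * Real.pi * inner ℝ v a) * I) •
      (2 * divSqAddSqDeriv A (2 * Real.pi * v)) =
      2 * (divSqAddSqDeriv A (2 * Real.pi * v) * cexp (I * a * (2 * Real.pi * v : ℝ))) := by
    intro v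
    have : (↑(2 * Real.pi * inner ℝ v a) * I : ℂ) = I * a * (2 * Real.pi * v : ℝ) := by
      simp
      ring
    rw [this, smul_eq_mul]
    ring
  simp_rw [hcongr] at hinv
  rw [hsubst, integral_const_mul, abs_of_pos (by positivity), Complex.real_smul] at hinv
  change _ = ((|a| * Real.exp (-(A * |a|)) : ℝ) : ℂ) at hinv
  rw [← hinv]
  have : (Real.pi : ℂ) ≠ 0 := by exact_mod_cast Real.pi_ne_zero
  push_cast
  field_simp

lemma hasDerivAt_div_sq_add_sq {A : ℝ} (hA : 0 < A) (ξ : ℝ) :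
    HasDerivAt (fun ξ : ℝ => (ξ : ℂ) / ((A : ℂ) ^ 2 + (ξ : ℂ) ^ 2)) (divSqAddSqDeriv A ξ) ξ := by
  have h1 : HasDerivAt (fun x : ℝ => (x : ℂ)) 1 ξ := ofRealCLM.hasDerivAt
  refine (h1.div ((h1.pow 2).const_add ((A : ℂ) ^ 2))
    (ofReal_sq_add_ofReal_sq_ne_zero hA ξ)).congr_deriv ?_
  unfold divSqAddSqDeriv
  congr 1
  simp
  ring

lemma norm_div_sq_add_sq_le (A : ℝ) {ξ : ℝ} (hξ : ξ ≠ 0) :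
    ‖(ξ : ℂ) / ((A : ℂ) ^ 2 + (ξ : ℂ) ^ 2)‖ ≤ |ξ|⁻¹ := by
  have hpos : 0 < A ^ 2 + ξ ^ 2 := by positivity
  have h : (ξ : ℂ) / ((A : ℂ) ^ 2 + (ξ : ℂ) ^ 2) = ((ξ / (A ^ 2 + ξ ^ 2) : ℝ) : ℂ) := by simp
  rw [h, Complex.norm_real, Real.norm_eq_abs, abs_div, abs_of_pos hpos, inv_eq_one_div,
    div_le_div_iff₀ hpos (abs_pos.2 hξ), ← pow_two, sq_abs]
  nlinarith [sq_nonneg A]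

lemma tendsto_div_sq_add_sq_mul_cexp (A a : ℝ) {l : Filter ℝ} {u : ℝ → ℝ}
    (hu : Tendsto (fun R => |u R|) l atTop) :
    Tendsto (fun R => (u R : ℂ) / ((A : ℂ) ^ 2 + (u R : ℂ) ^ 2) * cexp (I * a * u R))
      l (nhds 0) := by
  refine squeeze_zero_norm' ?_ (tendsto_inv_atTop_zero.comp hu)
  filter_upwards [hu.eventually_gt_atTop 0] with R hR
  have hn : ‖cexp (I * a * u R)‖ = 1 := by simp [Complex.norm_exp]
  rw [norm_mul, hn, mul_one]
  exact norm_div_sq_add_sq_le A (abs_pos.1 hR)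

/-- Integration by parts turns the conditionally convergent integrand into an integrable one. -/
lemma intervalIntegral_mul_cexp_div_sq_add_sq {A : ℝ} (hA : 0 < A) {a : ℝ} (ha : a ≠ 0)
    (R : ℝ) :
    ∫ ξ in (-R)..R, I * (ξ : ℂ) * cexp (I * a * ξ) / ((A : ℂ) ^ 2 + (ξ : ℂ) ^ 2) =
      1 / a * ((R : ℂ) / ((A : ℂ) ^ 2 + (R : ℂ) ^ 2) * cexp (I * a * R) -
        ((-R : ℝ) : ℂ) / ((A : ℂ) ^ 2 + ((-R : ℝ) : ℂ) ^ 2) * cexp (I * a * (-R : ℝ)) -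
        ∫ ξ in (-R)..R, divSqAddSqDeriv A ξ * cexp (I * a * ξ)) := by
  have ha' : (a : ℂ) ≠ 0 := by exact_mod_cast ha
  have hv : ∀ x : ℝ, HasDerivAt (fun ξ : ℝ => cexp (I * a * ξ)) (a * (I * cexp (I * a * x))) x := by
    intro x
    have h1 : HasDerivAt (fun x : ℝ => (x : ℂ)) 1 x := ofRealCLM.hasDerivAt
    exact (h1.const_mul (I * (a : ℂ))).cexp.congr_deriv (by ring)
  have hparts := intervalIntegral.integral_mul_deriv_eq_deriv_mul (a := -R) (b := R)
    (fun x _ => hasDerivAt_div_sq_add_sq hA x) (fun x _ => hv x)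
    ((continuous_divSqAddSqDeriv hA).intervalIntegrable _ _)
    (Continuous.intervalIntegrable (by fun_prop) _ _)
  rw [← hparts, ← intervalIntegral.integral_const_mul]
  congr 1
  ext ξ
  have := ofReal_sq_add_ofReal_sq_ne_zero hA ξ
  field_simp

/-- for `A > 0` and `a ≠ 0`, the symmetric improper integrals
`(1/(2π)) ∫_{−R}^{R} iξ e^{iaξ}/(A² + ξ²) dξ` converge as `R → ∞` to
`−sign(a) e^{−|a|A}/2`. -/
theorem statement9 (A : ℝ) (hA : 0 < A) (a : ℝ) (ha : a ≠ 0) :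
    Tendsto (fun R : ℝ =>
        (1 / (2 * (Real.pi : ℂ))) *
          ∫ ξ in (-R)..R,
            Complex.I * (ξ : ℂ) * Complex.exp (Complex.I * (a : ℂ) * (ξ : ℂ)) /
              ((A : ℂ) ^ 2 + (ξ : ℂ) ^ 2))
      atTop
      (nhds (-(((Real.sign a : ℝ) : ℂ)) * Complex.exp (-((|a| * A : ℝ) : ℂ)) / 2)) := by
  have hint : Integrable fun ξ : ℝ => divSqAddSqDeriv A ξ * cexp (I * a * ξ) := by
    refine (integrable_divSqAddSqDeriv hA).mono
      ((continuous_divSqAddSqDeriv hA).mul (by fun_prop)).aestronglyMeasurable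
      (ae_of_all _ fun ξ => ?_)
    simp [Complex.norm_exp]
  have hlim := intervalIntegral_tendsto_integral hint tendsto_neg_atTop_atBot tendsto_id
  rw [integral_divSqAddSqDeriv_mul_cexp hA] at hlim
  have htop := tendsto_div_sq_add_sq_mul_cexp A a (u := fun R => R) tendsto_abs_atTop_atTop
  have hbot := tendsto_div_sq_add_sq_mul_cexp A a (u := fun R => -R)
    (by simpa using tendsto_abs_atTop_atTop)
  have h := (((htop.sub hbot).sub hlim).const_mul (1 / (a : ℂ))).const_mul
    (1 / (2 * (Real.pi : ℂ)))
  simp_rw [intervalIntegral_mul_cexp_div_sq_add_sq hA ha]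
  convert! h using 2
  have hpi : (Real.pi : ℂ) ≠ 0 := by exact_mod_cast Real.pi_ne_zero
  have ha' : (a : ℂ) ≠ 0 := by exact_mod_cast ha
  have habs : ((|a| : ℝ) : ℂ) = Real.sign a * a := by
    rcases ha.lt_or_gt with h | h
    · simp [Real.sign_of_neg h, abs_of_neg h]
    · simp [Real.sign_of_pos h, abs_of_pos h]
  have hexp : cexp (-((|a| * A : ℝ) : ℂ)) = (Real.exp (-(A * |a|)) : ℝ) := by
    push_cast
    ring_nf
  rw [hexp, ofReal_mul, habs]
  field_simp
  ring
end

section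
/- Let A > 0 be a real number, let B ∈ ℂ with Re B > 0 and B ≠ A, and let x ∈ ℝ with x ≠ 0. Define M(a) = (e^{−Ba} − e^{−Aa})/(B − A) for a > 0. Then the function y ↦ (e^{−|x−y|A} − e^{−|x+y|A}) e^{−By} is integrable on (0,∞) and ∫_0^∞ (e^{−|x−y|A} − e^{−|x+y|A}) e^{−By} dy = −sign(x) · (2A/(B + A)) · M(|x|), where sign(x) = 1 for x > 0 and sign(x) = −1 for x < 0. -/
open MeasureTheory Complex

lemma integrableOn_and_integral_exp_neg_abs_sub_mul_exp_Ioi {A a : ℝ} {B : ℂ} (hA : 0 < A)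
    (hB : 0 < B.re) (hBA : B ≠ (A : ℂ)) (ha : 0 < a) :
    IntegrableOn (fun y : ℝ =>
      ((Real.exp (-(|a - y| * A)) : ℝ) : ℂ) * Complex.exp (-B * (y : ℂ))) (Set.Ioi 0) ∧
    ∫ y in Set.Ioi (0 : ℝ), ((Real.exp (-(|a - y| * A)) : ℝ) : ℂ) * Complex.exp (-B * (y : ℂ))
      = (Complex.exp (-B * a) - Complex.exp (-A * a)) / (A - B)
        + Complex.exp (-B * a) / (B + A) := by
  have hre : (-(B + A)).re < 0 := by
    simp only [neg_re, add_re, ofReal_re]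
    linarith
  have hsub : (A : ℂ) - B ≠ 0 := sub_ne_zero.mpr hBA.symm
  have hlt : Set.EqOn (fun y : ℝ =>
      ((Real.exp (-(|a - y| * A)) : ℝ) : ℂ) * Complex.exp (-B * (y : ℂ)))
      (fun y : ℝ => Complex.exp (-A * a) * Complex.exp ((A - B) * y)) (Set.Ioc 0 a) := by
    intro y hy
    simp only [abs_of_nonneg (sub_nonneg.mpr hy.2)]
    push_cast
    rw [← Complex.exp_add, ← Complex.exp_add]
    ring_nf
  have hgt : Set.EqOn (fun y : ℝ =>
      ((Real.exp (-(|a - y| * A)) : ℝ) : ℂ) * Complex.exp (-B * (y : ℂ)))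
      (fun y : ℝ => Complex.exp (A * a) * Complex.exp (-(B + A) * y)) (Set.Ioi a) := by
    intro y hy
    simp only [abs_of_neg (sub_neg.mpr (Set.mem_Ioi.mp hy))]
    push_cast
    rw [← Complex.exp_add, ← Complex.exp_add]
    ring_nf
  have hintlt : IntegrableOn (fun y : ℝ =>
      ((Real.exp (-(|a - y| * A)) : ℝ) : ℂ) * Complex.exp (-B * (y : ℂ))) (Set.Ioc 0 a) :=
    Continuous.integrableOn_Ioc (by fun_prop)
  have hintgt : IntegrableOn (fun y : ℝ =>
      ((Real.exp (-(|a - y| * A)) : ℝ) : ℂ) * Complex.exp (-B * (y : ℂ))) (Set.Ioi a) :=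
    IntegrableOn.congr_fun ((integrableOn_exp_mul_complex_Ioi hre a).const_mul _) hgt.symm
      measurableSet_Ioi
  rw [← Set.Ioc_union_Ioi_eq_Ioi ha.le]
  refine ⟨hintlt.union hintgt, ?_⟩
  rw [setIntegral_union (Set.Ioc_disjoint_Ioi le_rfl) measurableSet_Ioi hintlt hintgt,
    setIntegral_congr_fun measurableSet_Ioc hlt, setIntegral_congr_fun measurableSet_Ioi hgt,
    integral_const_mul, integral_const_mul, integral_exp_mul_complex_Ioi hre,
    ← intervalIntegral.integral_of_le ha.le, integral_exp_mul_complex hsub,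
    neg_div_neg_eq, mul_div_assoc', mul_div_assoc', mul_sub, ← Complex.exp_add,
    ← Complex.exp_add, ← Complex.exp_add, ofReal_zero]
  ring_nf

lemma integrableOn_and_integral_exp_neg_abs_add_mul_exp_Ioi {A a : ℝ} {B : ℂ} (hA : 0 < A)
    (hB : 0 < B.re) (ha : 0 < a) :
    IntegrableOn (fun y : ℝ =>
      ((Real.exp (-(|a + y| * A)) : ℝ) : ℂ) * Complex.exp (-B * (y : ℂ))) (Set.Ioi 0) ∧
    ∫ y in Set.Ioi (0 : ℝ), ((Real.exp (-(|a + y| * A)) : ℝ) : ℂ) * Complex.exp (-B * (y : ℂ))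
      = Complex.exp (-A * a) / (B + A) := by
  have hre : (-(B + A)).re < 0 := by
    simp only [neg_re, add_re, ofReal_re]
    linarith
  have heq : Set.EqOn (fun y : ℝ =>
      ((Real.exp (-(|a + y| * A)) : ℝ) : ℂ) * Complex.exp (-B * (y : ℂ)))
      (fun y : ℝ => Complex.exp (-A * a) * Complex.exp (-(B + A) * y)) (Set.Ioi 0) := by
    intro y hy
    simp only [abs_of_pos (add_pos ha (Set.mem_Ioi.mp hy))]
    push_cast
    rw [← Complex.exp_add, ← Complex.exp_add]
    ring_nf
  refine ⟨IntegrableOn.congr_fun ((integrableOn_exp_mul_complex_Ioi hre 0).const_mul _) heq.symm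
    measurableSet_Ioi, ?_⟩
  rw [setIntegral_congr_fun measurableSet_Ioi heq, integral_const_mul,
    integral_exp_mul_complex_Ioi hre, neg_div_neg_eq]
  simp [div_eq_mul_inv]

lemma integrableOn_and_integral_exp_neg_abs_sub_sub_exp_neg_abs_add_mul_exp_Ioi {A a : ℝ} {B : ℂ}
    (hA : 0 < A) (hB : 0 < B.re) (hBA : B ≠ (A : ℂ)) (ha : 0 < a) :
    IntegrableOn (fun y : ℝ =>
      (((Real.exp (-(|a - y| * A)) - Real.exp (-(|a + y| * A))) : ℝ) : ℂ) *
        Complex.exp (-B * (y : ℂ))) (Set.Ioi 0) ∧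
    ∫ y in Set.Ioi (0 : ℝ),
        (((Real.exp (-(|a - y| * A)) - Real.exp (-(|a + y| * A))) : ℝ) : ℂ) *
          Complex.exp (-B * (y : ℂ))
      = -(2 * (A : ℂ) / (B + (A : ℂ))) *
        ((Complex.exp (-B * a) - Complex.exp (-A * a)) / (B - A)) := by
  obtain ⟨hsub, hsub_eq⟩ := integrableOn_and_integral_exp_neg_abs_sub_mul_exp_Ioi hA hB hBA ha
  obtain ⟨hadd, hadd_eq⟩ := integrableOn_and_integral_exp_neg_abs_add_mul_exp_Ioi hA hB ha
  have hne : B + A ≠ 0 := by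
    intro h
    have := congrArg Complex.re h
    simp only [add_re, ofReal_re, zero_re] at this
    linarith
  have h₁ : (A : ℂ) - B ≠ 0 := sub_ne_zero.mpr hBA.symm
  have h₂ : B - (A : ℂ) ≠ 0 := sub_ne_zero.mpr hBA
  simp only [ofReal_sub, sub_mul]
  refine ⟨hsub.sub hadd, ?_⟩
  rw [integral_sub hsub hadd, hsub_eq, hadd_eq, ← neg_sub B (A : ℂ)]
  field_simp
  ring

/-- let `A > 0`, `B ∈ ℂ` with `Re B > 0` and `B ≠ A`, `x ≠ 0`, and
`M(a) = (e^{−Ba} − e^{−Aa})/(B − A)`. Then `y ↦ (e^{−|x−y|A} − e^{−|x+y|A}) e^{−By}` is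
integrable on `(0,∞)` and
`∫_0^∞ (e^{−|x−y|A} − e^{−|x+y|A}) e^{−By} dy = −sign(x) (2A/(B+A)) M(|x|)`. -/
theorem statement10 (A : ℝ) (hA : 0 < A) (B : ℂ) (hB : 0 < B.re) (hBA : B ≠ (A : ℂ))
    (x : ℝ) (hx : x ≠ 0)
    (M : ℝ → ℂ)
    (hM : ∀ a : ℝ, 0 < a →
      M a = (Complex.exp (-B * (a : ℂ)) - Complex.exp (-(A : ℂ) * (a : ℂ))) / (B - (A : ℂ))) :
    IntegrableOn (fun y : ℝ =>
      (((Real.exp (-(|x - y| * A)) - Real.exp (-(|x + y| * A))) : ℝ) : ℂ) *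
        Complex.exp (-B * (y : ℂ))) (Set.Ioi 0) ∧
    ∫ y in Set.Ioi (0 : ℝ),
        (((Real.exp (-(|x - y| * A)) - Real.exp (-(|x + y| * A))) : ℝ) : ℂ) *
          Complex.exp (-B * (y : ℂ))
      = -(((Real.sign x : ℝ) : ℂ)) * (2 * (A : ℂ) / (B + (A : ℂ))) * M |x| := by
  rcases lt_or_gt_of_ne hx with hneg | hpos
  · obtain ⟨hint, heq⟩ :=
      integrableOn_and_integral_exp_neg_abs_sub_sub_exp_neg_abs_add_mul_exp_Ioi hA hB hBA
        (neg_pos.mpr hneg)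
    have hfun : (fun y : ℝ =>
        (((Real.exp (-(|x - y| * A)) - Real.exp (-(|x + y| * A))) : ℝ) : ℂ) *
          Complex.exp (-B * (y : ℂ))) = fun y : ℝ =>
        -((((Real.exp (-(|-x - y| * A)) - Real.exp (-(|-x + y| * A))) : ℝ) : ℂ) *
          Complex.exp (-B * (y : ℂ))) := by
      funext y
      rw [show -x - y = -(x + y) by ring, show -x + y = -(x - y) by ring, abs_neg, abs_neg]
      push_cast
      ring
    rw [hfun]
    refine ⟨hint.neg, ?_⟩
    rw [integral_neg, heq, abs_of_neg hneg, hM _ (neg_pos.mpr hneg), Real.sign_of_neg hneg]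
    push_cast
    ring
  · obtain ⟨hint, heq⟩ :=
      integrableOn_and_integral_exp_neg_abs_sub_sub_exp_neg_abs_add_mul_exp_Ioi hA hB hBA hpos
    refine ⟨hint, ?_⟩
    rw [heq, abs_of_pos hpos, hM _ hpos, Real.sign_of_pos hpos]
    push_cast
    ring
end

section
/- Let A > 0 be a real number, let B ∈ ℂ with Re B > 0 and B ≠ A, and let x ∈ ℝ with x ≠ 0. Define M(a) = (e^{−Ba} − e^{−Aa})/(B − A) for a > 0, and sign(t) = 1 for t > 0, sign(t) = −1 for t < 0, sign(0) = 0. Then the function y ↦ (sign(x−y) e^{−|x−y|A} − sign(x+y) e^{−|x+y|A}) e^{−By} is integrable on (0,∞) and ∫_0^∞ (sign(x−y) e^{−|x−y|A} − sign(x+y) e^{−|x+y|A}) e^{−By} dy = −(2A/(B + A)) · M(|x|) − (2/(B + A)) · e^{−B|x|}. -/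
open MeasureTheory Complex

/-- The odd reflection `sign (x - y) e^{-|x - y| A} - sign (x + y) e^{-|x + y| A}` of the kernel
`sign t e^{-|t| A}`. -/
noncomputable def oddKernel (A x y : ℝ) : ℝ :=
  Real.sign (x - y) * Real.exp (-(|x - y| * A)) - Real.sign (x + y) * Real.exp (-(|x + y| * A))

lemma oddKernel_neg (A x y : ℝ) : oddKernel A (-x) y = oddKernel A x y := by
  have h₁ : -x - y = -(x + y) := by ring
  have h₂ : -x + y = -(x - y) := by ring
  simp only [oddKernel, h₁, h₂, abs_neg, Real.sign_neg]
  ring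

lemma oddKernel_abs (A x y : ℝ) : oddKernel A |x| y = oddKernel A x y := by
  rcases abs_choice x with h | h <;> simp [h, oddKernel_neg]

lemma oddKernel_mul_exp_of_lt {A a y : ℝ} (B : ℂ) (hy : 0 < y) (hya : y < a) :
    (oddKernel A a y : ℂ) * exp (-B * y) =
      exp (-A * a) * exp ((A - B) * y) - exp (-A * a) * exp (-(A + B) * y) := by
  have h₁ : 0 < a - y := by linarith
  have h₂ : 0 < a + y := by linarith
  simp only [oddKernel, Real.sign_of_pos h₁, Real.sign_of_pos h₂, abs_of_pos h₁, abs_of_pos h₂]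
  push_cast
  simp only [one_mul, sub_mul, ← Complex.exp_add]
  ring_nf

lemma oddKernel_mul_exp_of_gt {A a y : ℝ} (B : ℂ) (ha : 0 < a) (hay : a < y) :
    (oddKernel A a y : ℂ) * exp (-B * y) =
      -exp (A * a) * exp (-(A + B) * y) - exp (-A * a) * exp (-(A + B) * y) := by
  have h₁ : a - y < 0 := by linarith
  have h₂ : 0 < a + y := by linarith
  simp only [oddKernel, Real.sign_of_neg h₁, Real.sign_of_pos h₂, abs_of_neg h₁, abs_of_pos h₂]
  push_cast
  simp only [one_mul, sub_mul, neg_mul, ← Complex.exp_add]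
  ring_nf

lemma integrableOn_oddKernel_mul_exp_Ioc (A : ℝ) (B : ℂ) (a : ℝ) :
    IntegrableOn (fun y : ℝ => (oddKernel A a y : ℂ) * exp (-B * y)) (Set.Ioc 0 a) := by
  rw [integrableOn_Ioc_iff_integrableOn_Ioo]
  refine IntegrableOn.congr_fun (f := fun y : ℝ =>
    exp (-A * a) * exp ((A - B) * y) - exp (-A * a) * exp (-(A + B) * y)) ?_
    (fun y hy => (oddKernel_mul_exp_of_lt B hy.1 hy.2).symm) measurableSet_Ioo
  exact (Continuous.integrableOn_Icc (by fun_prop)).mono_set Set.Ioo_subset_Icc_self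

lemma integrableOn_oddKernel_mul_exp_Ioi {A a : ℝ} {B : ℂ} (ha : 0 < a) (hAB : 0 < A + B.re) :
    IntegrableOn (fun y : ℝ => (oddKernel A a y : ℂ) * exp (-B * y)) (Set.Ioi a) := by
  have hexp : IntegrableOn (fun y : ℝ => exp (-(A + B) * y)) (Set.Ioi a) :=
    integrableOn_exp_mul_complex_Ioi (by simp only [neg_re, add_re, ofReal_re]; linarith) a
  exact IntegrableOn.congr_fun ((hexp.const_mul _).sub (hexp.const_mul _))
    (fun y hy => (oddKernel_mul_exp_of_gt B ha hy).symm) measurableSet_Ioi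

lemma integral_oddKernel_mul_exp_Ioc {A a : ℝ} {B : ℂ} (ha : 0 ≤ a) (hsub : (A : ℂ) - B ≠ 0)
    (hadd : (A : ℂ) + B ≠ 0) :
    ∫ y in Set.Ioc 0 a, (oddKernel A a y : ℂ) * exp (-B * y) =
      exp (-A * a) * ((exp ((A - B) * a) - 1) / (A - B)) -
        exp (-A * a) * ((exp (-(A + B) * a) - 1) / -(A + B)) := by
  rw [integral_Ioc_eq_integral_Ioo, setIntegral_congr_fun measurableSet_Ioo
    (fun y hy => oddKernel_mul_exp_of_lt B hy.1 hy.2), ← integral_Ioc_eq_integral_Ioo,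
    ← intervalIntegral.integral_of_le ha, intervalIntegral.integral_sub
      (Continuous.intervalIntegrable (by fun_prop) _ _)
      (Continuous.intervalIntegrable (by fun_prop) _ _),
    intervalIntegral.integral_const_mul, intervalIntegral.integral_const_mul,
    integral_exp_mul_complex hsub, integral_exp_mul_complex (neg_ne_zero.mpr hadd)]
  simp

lemma integral_oddKernel_mul_exp_Ioi {A a : ℝ} {B : ℂ} (ha : 0 < a) (hAB : 0 < A + B.re) :
    ∫ y in Set.Ioi a, (oddKernel A a y : ℂ) * exp (-B * y) =
      (-exp (A * a) - exp (-A * a)) * (-exp (-(A + B) * a) / -(A + B)) := by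
  have hre : (-((A : ℂ) + B)).re < 0 := by simp only [neg_re, add_re, ofReal_re]; linarith
  rw [setIntegral_congr_fun measurableSet_Ioi (fun y hy => oddKernel_mul_exp_of_gt B ha hy)]
  simp_rw [← sub_mul]
  rw [integral_const_mul, integral_exp_mul_complex_Ioi hre]

/-- let `A > 0`, `B ∈ ℂ` with `Re B > 0` and `B ≠ A`, `x ≠ 0`, and
`M(a) = (e^{−Ba} − e^{−Aa})/(B − A)`. Then
`y ↦ (sign(x−y) e^{−|x−y|A} − sign(x+y) e^{−|x+y|A}) e^{−By}` is integrable on `(0,∞)` and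
`∫_0^∞ (sign(x−y) e^{−|x−y|A} − sign(x+y) e^{−|x+y|A}) e^{−By} dy
  = −(2A/(B+A)) M(|x|) − (2/(B+A)) e^{−B|x|}`. -/
theorem statement11 (A : ℝ) (hA : 0 < A) (B : ℂ) (hB : 0 < B.re) (hBA : B ≠ (A : ℂ))
    (x : ℝ) (hx : x ≠ 0)
    (M : ℝ → ℂ)
    (hM : ∀ a : ℝ, 0 < a →
      M a = (Complex.exp (-B * (a : ℂ)) - Complex.exp (-(A : ℂ) * (a : ℂ))) / (B - (A : ℂ))) :
    IntegrableOn (fun y : ℝ =>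
      (((Real.sign (x - y) * Real.exp (-(|x - y| * A))
          - Real.sign (x + y) * Real.exp (-(|x + y| * A))) : ℝ) : ℂ) *
        Complex.exp (-B * (y : ℂ))) (Set.Ioi 0) ∧
    ∫ y in Set.Ioi (0 : ℝ),
        (((Real.sign (x - y) * Real.exp (-(|x - y| * A))
            - Real.sign (x + y) * Real.exp (-(|x + y| * A))) : ℝ) : ℂ) *
          Complex.exp (-B * (y : ℂ))
      = -(2 * (A : ℂ) / (B + (A : ℂ))) * M |x|
          - (2 / (B + (A : ℂ))) * Complex.exp (-B * ((|x| : ℝ) : ℂ)) := by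
  have ha : 0 < |x| := abs_pos.mpr hx
  have hAB : 0 < A + B.re := by linarith
  have hadd : (A : ℂ) + B ≠ 0 := fun h => hAB.ne' (by simpa using congrArg re h)
  have hadd' : B + (A : ℂ) ≠ 0 := by rwa [add_comm]
  have hsub : (A : ℂ) - B ≠ 0 := sub_ne_zero.mpr hBA.symm
  have hsub' : B - (A : ℂ) ≠ 0 := sub_ne_zero.mpr hBA
  change IntegrableOn (fun y : ℝ => (oddKernel A x y : ℂ) * exp (-B * y)) (Set.Ioi 0) ∧
    ∫ y in Set.Ioi (0 : ℝ), (oddKernel A x y : ℂ) * exp (-B * y) = _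
  simp_rw [← oddKernel_abs A x, hM |x| ha]
  generalize |x| = a at ha
  have hIoc := integrableOn_oddKernel_mul_exp_Ioc A B a
  have hIoi := integrableOn_oddKernel_mul_exp_Ioi ha hAB
  rw [← Set.Ioc_union_Ioi_eq_Ioi ha.le]
  refine ⟨hIoc.union hIoi, ?_⟩
  rw [setIntegral_union Set.Ioc_disjoint_Ioi_same measurableSet_Ioi hIoc hIoi,
    integral_oddKernel_mul_exp_Ioc ha.le hsub hadd, integral_oddKernel_mul_exp_Ioi ha hAB]
  have h₁ : exp ((A - B) * a) = exp (A * a) * exp (-B * a) := by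
    rw [← Complex.exp_add]; ring_nf
  have h₂ : exp (-(A + B) * a) = exp (-A * a) * exp (-B * a) := by
    rw [← Complex.exp_add]; ring_nf
  have h₃ : exp (A * a) = (exp (-A * a))⁻¹ := by
    rw [← Complex.exp_neg]; ring_nf
  have h₄ := Complex.exp_ne_zero (-A * a)
  rw [h₁, h₂, h₃]
  generalize exp (-A * a) = u at *
  generalize exp (-B * a) = v at *
  rw [← neg_sub B (A : ℂ), add_comm (A : ℂ) B]
  field_simp
  ring
end

section
/- Let X be a Banach space, let Λ be a set, let p ∈ [1,∞), and let A : Λ → L(X) be a family of bounded linear operators on X such that the family {A(λ) : λ ∈ Λ} is R-bounded with exponent p and R-bound τ < 1. Then for every λ ∈ Λ the operator I − A(λ) is invertible in L(X), with inverse given by the Neumann series Σ_{n=0}^∞ A(λ)^n, and the family {(I − A(λ))^{-1} : λ ∈ Λ} is R-bounded with exponent p and R-bound at most (1 − τ)^{-1}. -/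
open scoped BigOperators
open Filter

/-- The Rademacher sign attached to a boolean. -/
noncomputable def radSign (b : Bool) : ℝ := if b then 1 else -1

/-- A family `𝒯` of bounded linear operators from `X` to `Y` is R-bounded with exponent
`p ∈ [1,∞)` and bound `C`. -/
def RBounded {X Y : Type*} [NormedAddCommGroup X] [NormedSpace ℝ X]
    [NormedAddCommGroup Y] [NormedSpace ℝ Y]
    (p : ℝ) (𝒯 : Set (X →L[ℝ] Y)) (C : ℝ) : Prop :=
  ∀ (n : ℕ) (T : Fin n → X →L[ℝ] Y) (f : Fin n → X), (∀ j, T j ∈ 𝒯) →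
    (((2 : ℝ) ^ n)⁻¹ * ∑ ε : Fin n → Bool,
        ‖∑ j, radSign (ε j) • (T j) (f j)‖ ^ p) ^ (1 / p) ≤
      C * (((2 : ℝ) ^ n)⁻¹ * ∑ ε : Fin n → Bool,
        ‖∑ j, radSign (ε j) • f j‖ ^ p) ^ (1 / p)

/-- The `L^p` norm of the Rademacher sum `∑ j, ε j • f j`. -/
noncomputable def radNorm {X : Type*} [NormedAddCommGroup X] [NormedSpace ℝ X]
    (p : ℝ) {n : ℕ} (f : Fin n → X) : ℝ :=
  (((2 : ℝ) ^ n)⁻¹ * ∑ ε : Fin n → Bool, ‖∑ j, radSign (ε j) • f j‖ ^ p) ^ (1 / p)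

lemma abs_radSign (b : Bool) : |radSign b| = 1 := by
  cases b <;> simp [radSign]

section

variable {X : Type*} [NormedAddCommGroup X] [NormedSpace ℝ X]

lemma radNorm_add_le {p : ℝ} (hp : 1 ≤ p) {n : ℕ} (f g : Fin n → X) :
    radNorm p (fun j => f j + g j) ≤ radNorm p f + radNorm p g := by
  have hfactor (h : Fin n → X) : radNorm p h = (((2 : ℝ) ^ n)⁻¹) ^ (1 / p) *
      (∑ ε : Fin n → Bool, ‖∑ j, radSign (ε j) • h j‖ ^ p) ^ (1 / p) :=
    Real.mul_rpow (by positivity) (by positivity)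
  rw [hfactor, hfactor, hfactor, ← mul_add]
  refine mul_le_mul_of_nonneg_left ?_ (by positivity)
  refine le_trans ?_ (Real.Lp_add_le_of_nonneg Finset.univ hp
    (fun ε _ => norm_nonneg (∑ j, radSign (ε j) • f j))
    (fun ε _ => norm_nonneg (∑ j, radSign (ε j) • g j)))
  gcongr with ε
  simp only [smul_add, Finset.sum_add_distrib]
  exact norm_add_le _ _

lemma radNorm_const_one {p : ℝ} (hp : 1 ≤ p) (x : X) :
    radNorm p (fun _ : Fin 1 => x) = ‖x‖ := by
  have hp0 : p ≠ 0 := by positivity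
  simp [radNorm, norm_smul, abs_radSign, Real.rpow_rpow_inv (norm_nonneg x) hp0]

lemma RBounded.norm_apply_le {p : ℝ} (hp : 1 ≤ p) {Y : Type*} [NormedAddCommGroup Y]
    [NormedSpace ℝ Y] {𝒯 : Set (X →L[ℝ] Y)} {C : ℝ} (h : RBounded p 𝒯 C)
    {T : X →L[ℝ] Y} (hT : T ∈ 𝒯) (x : X) : ‖T x‖ ≤ C * ‖x‖ := by
  rw [← radNorm_const_one hp x, ← radNorm_const_one hp (T x)]
  exact h 1 (fun _ => T) (fun _ => x) fun _ => hT

/-- Right inverses of `1 - T`, with `T` in an R-bounded family of bound `τ < 1`, form an R-bounded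
family of bound `(1 - τ)⁻¹`. -/
lemma RBounded.of_one_sub_mul_eq_one {p : ℝ} (hp : 1 ≤ p) {𝒯 𝒮 : Set (X →L[ℝ] X)} {τ : ℝ}
    (hτ : τ < 1) (h : RBounded p 𝒯 τ) (h𝒮 : ∀ S ∈ 𝒮, ∃ T ∈ 𝒯, (1 - T) * S = 1) :
    RBounded p 𝒮 (1 - τ)⁻¹ := by
  intro n S f hS
  choose T hT hTS using fun j => h𝒮 (S j) (hS j)
  have hg : (fun j => S j (f j)) = fun j => f j + T j (S j (f j)) := by
    funext j
    have := DFunLike.congr_fun (hTS j) (f j)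
    simpa [sub_eq_iff_eq_add] using this
  have htri := radNorm_add_le hp f fun j => T j (S j (f j))
  rw [← hg] at htri
  have hb : radNorm p (fun j => T j (S j (f j))) ≤ τ * radNorm p (fun j => S j (f j)) :=
    h n T (fun j => S j (f j)) hT
  change radNorm p (fun j => S j (f j)) ≤ (1 - τ)⁻¹ * radNorm p f
  rw [le_inv_mul_iff₀ (sub_pos.2 hτ)]
  linarith

end

/-- Neumann series: let `X` be a Banach space, `Λ` a set, `p ∈ [1,∞)`, and
`A : Λ → L(X)` a family that is R-bounded with exponent `p` and R-bound `τ < 1`. Then each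
`I − A(λ)` is invertible in `L(X)` with inverse given by the Neumann series `Σ_n A(λ)^n`,
and the family of inverses `{(I − A(λ))⁻¹ : λ ∈ Λ}` is R-bounded with exponent `p` and
R-bound at most `(1 − τ)⁻¹`. -/
theorem statement15 {X : Type*} [NormedAddCommGroup X] [NormedSpace ℝ X] [CompleteSpace X]
    {Λ : Type*} (p : ℝ) (hp : 1 ≤ p) (A : Λ → X →L[ℝ] X) (τ : ℝ) (hτ : τ < 1)
    (hR : RBounded p {T : X →L[ℝ] X | ∃ l, T = A l} τ) :
    ∃ Binv : Λ → X →L[ℝ] X,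
      (∀ l, HasSum (fun n : ℕ => (A l) ^ n) (Binv l)) ∧
      (∀ l, (1 - A l) * Binv l = 1 ∧ Binv l * (1 - A l) = 1) ∧
      RBounded p {T : X →L[ℝ] X | ∃ l, T = Binv l} ((1 - τ)⁻¹) := by
  have hnorm (l : Λ) : ‖A l‖ < 1 := by
    refine lt_of_le_of_lt (ContinuousLinearMap.opNorm_le_bound _ (le_max_right τ 0) fun x => ?_)
      (max_lt hτ one_pos)
    exact (hR.norm_apply_le hp ⟨l, rfl⟩ x).trans
      (mul_le_mul_of_nonneg_right (le_max_left τ 0) (norm_nonneg x))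
  have hinv (l : Λ) : (1 - A l) * ∑' n : ℕ, A l ^ n = 1 := mul_neg_geom_series (A l) (hnorm l)
  refine ⟨fun l => ∑' n : ℕ, A l ^ n,
    fun l => (summable_geometric_of_norm_lt_one (hnorm l)).hasSum,
    fun l => ⟨hinv l, geom_series_mul_neg (A l) (hnorm l)⟩,
    hR.of_one_sub_mul_eq_one hp hτ ?_⟩
  rintro _ ⟨l, rfl⟩
  exact ⟨A l, ⟨l, rfl⟩, hinv l⟩
end

section
/- Let N ≥ 1 be an integer, let r > N be a real number, let μ : ℝ^N → ℝ be continuously differentiable, let x₀ ∈ ℝ^N, and let d > 0. Then ( ∫_{B_d(x₀)} |μ(x) − μ(x₀)|^r dx )^{1/r} ≤ (r/(r−N)) · d · ( ∫_{B_d(x₀)} ‖∇μ(x)‖^r dx )^{1/r}. -/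
open MeasureTheory

open Set Module
open scoped ENNReal

/-- A `C¹` function varies along a segment by at most the length of the segment times the average
of the norm of its derivative. -/
theorem ContDiff.enorm_sub_le_mul_lintegral_enorm_fderiv {E F : Type*} [NormedAddCommGroup E]
    [NormedSpace ℝ E] [NormedAddCommGroup F] [NormedSpace ℝ F] {u : E → F}
    (hu : ContDiff ℝ 1 u) (x₀ x : E) :
    ‖u x - u x₀‖ₑ ≤ ‖x - x₀‖ₑ * ∫⁻ t in Ioo (0 : ℝ) 1, ‖fderiv ℝ u (x₀ + t • (x - x₀))‖ₑ := by
  have hline : ContDiff ℝ 1 fun t : ℝ ↦ u (x₀ + t • (x - x₀)) := by fun_prop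
  have hderiv (t : ℝ) : deriv (fun t : ℝ ↦ u (x₀ + t • (x - x₀))) t =
      fderiv ℝ u (x₀ + t • (x - x₀)) (x - x₀) := by
    have h₁ : HasDerivAt (fun t : ℝ ↦ x₀ + t • (x - x₀)) (x - x₀) t := by
      simpa using ((hasDerivAt_id t).smul_const (x - x₀)).const_add x₀
    exact ((hu.differentiable one_ne_zero _).hasFDerivAt.comp_hasDerivAt t h₁).deriv
  have h := enorm_sub_le_lintegral_deriv_of_contDiffOn_Icc
    (hline.contDiffOn (s := Icc (0 : ℝ) 1)) zero_le_one
  simp only [one_smul, zero_smul, add_zero, add_sub_cancel] at h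
  rw [← restrict_Ioo_eq_restrict_Icc] at h
  refine h.trans ?_
  rw [← lintegral_const_mul' _ _ enorm_ne_top]
  refine lintegral_mono fun t ↦ ?_
  rw [hderiv, mul_comm]
  exact ContinuousLinearMap.le_opENorm _ _

theorem lintegral_Ioo_zero_one_rpow_neg {s : ℝ} (hs : s < 1) :
    ∫⁻ t in Ioo (0 : ℝ) 1, ENNReal.ofReal (t ^ (-s)) = ENNReal.ofReal (1 / (1 - s)) := by
  have hint : IntegrableOn (fun t : ℝ ↦ t ^ (-s)) (Ioo 0 1) := by
    rw [← integrableOn_Ioc_iff_integrableOn_Ioo,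
      ← intervalIntegrable_iff_integrableOn_Ioc_of_le zero_le_one]
    exact intervalIntegral.intervalIntegrable_rpow' (by linarith)
  rw [← ofReal_integral_eq_lintegral_ofReal hint, ← integral_Ioc_eq_integral_Ioo,
    ← intervalIntegral.integral_of_le zero_le_one, integral_rpow (Or.inl (by linarith)),
    Real.one_rpow, Real.zero_rpow (by linarith), sub_zero, neg_add_eq_sub]
  filter_upwards [ae_restrict_mem measurableSet_Ioo] with t ht
  exact Real.rpow_nonneg ht.1.le _

/-- Hölder's inequality on `(0, 1)` with a power weight. -/
theorem lintegral_Ioo_zero_one_rpow_le {r s : ℝ} (hr : 1 < r) (hs : s < 1) {g : ℝ → ℝ≥0∞}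
    (hg : Measurable g) :
    (∫⁻ t in Ioo (0 : ℝ) 1, g t) ^ r ≤ ENNReal.ofReal (1 / (1 - s)) ^ (r - 1) *
      ∫⁻ t in Ioo (0 : ℝ) 1, ENNReal.ofReal (t ^ (s * (r - 1))) * g t ^ r := by
  have hpq := Real.HolderConjugate.conjExponent hr
  set q := r.conjExponent
  have hr₀ : r ≠ 0 := by positivity
  have hq₀ : q ≠ 0 := hpq.symm.ne_zero
  have hrq : r / q = r - 1 := hpq.div_conj_eq_sub_one
  have hm (a : ℝ) : Measurable fun t : ℝ ↦ ENNReal.ofReal (t ^ a) :=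
    (measurable_id.pow_const a).ennreal_ofReal
  have hpow (a b : ℝ) {t : ℝ} (ht : 0 < t) :
      ENNReal.ofReal (t ^ a) ^ b = ENNReal.ofReal (t ^ (a * b)) := by
    rw [ENNReal.ofReal_rpow_of_pos (Real.rpow_pos_of_pos ht a), Real.rpow_mul ht.le]
  have h := ENNReal.lintegral_mul_le_Lp_mul_Lq (volume.restrict (Ioo (0 : ℝ) 1)) hpq
    (((hm (s / q)).mul hg).aemeasurable) (hm (-(s / q))).aemeasurable
  have h₁ : ∫⁻ t in Ioo (0 : ℝ) 1, g t = ∫⁻ t in Ioo (0 : ℝ) 1,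
      (((fun t : ℝ ↦ ENNReal.ofReal (t ^ (s / q))) * g) *
        fun t : ℝ ↦ ENNReal.ofReal (t ^ (-(s / q)))) t := by
    refine setLIntegral_congr_fun measurableSet_Ioo fun t ht ↦ ?_
    simp only [Pi.mul_apply]
    rw [mul_right_comm, ← ENNReal.ofReal_mul (Real.rpow_nonneg ht.1.le _),
      ← Real.rpow_add ht.1, add_neg_cancel, Real.rpow_zero, ENNReal.ofReal_one, one_mul]
  have h₂ : ∫⁻ t in Ioo (0 : ℝ) 1, ((fun t : ℝ ↦ ENNReal.ofReal (t ^ (s / q))) * g) t ^ r =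
      ∫⁻ t in Ioo (0 : ℝ) 1, ENNReal.ofReal (t ^ (s * (r - 1))) * g t ^ r := by
    refine setLIntegral_congr_fun measurableSet_Ioo fun t ht ↦ ?_
    simp only [Pi.mul_apply]
    rw [ENNReal.mul_rpow_of_nonneg _ _ (by positivity), hpow _ _ ht.1, ← hrq, div_mul_eq_mul_div,
      mul_div_assoc]
  have h₃ : ∫⁻ t in Ioo (0 : ℝ) 1, ENNReal.ofReal (t ^ (-(s / q))) ^ q =
      ENNReal.ofReal (1 / (1 - s)) := by
    rw [← lintegral_Ioo_zero_one_rpow_neg hs]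
    refine setLIntegral_congr_fun measurableSet_Ioo fun t ht ↦ ?_
    rw [hpow _ _ ht.1, neg_mul, div_mul_cancel₀ _ hq₀]
  rw [← h₁, h₂, h₃] at h
  refine (ENNReal.rpow_le_rpow h (by positivity)).trans_eq ?_
  rw [ENNReal.mul_rpow_of_nonneg _ _ (by positivity), ← ENNReal.rpow_mul, ← ENNReal.rpow_mul,
    one_div_mul_cancel hr₀, ENNReal.rpow_one, one_div_mul_eq_div, hrq, mul_comm]

section Haar

variable {E : Type*} [NormedAddCommGroup E] [NormedSpace ℝ E] [FiniteDimensional ℝ E]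
  [MeasurableSpace E] [BorelSpace E] (ν : Measure E) [ν.IsAddHaarMeasure]

theorem lintegral_comp_homothety {f : E → ℝ≥0∞} (hf : Measurable f) (x₀ : E) {t : ℝ}
    (ht : 0 < t) :
    ∫⁻ x, f (x₀ + t • (x - x₀)) ∂ν =
      ENNReal.ofReal (t ^ (-(finrank ℝ E : ℝ))) * ∫⁻ x, f x ∂ν := by
  rw [lintegral_sub_right_eq_self (fun y ↦ f (x₀ + t • y)) x₀,
    ← lintegral_map (f := fun y ↦ f (x₀ + y)) (hf.comp (measurable_const_add x₀))
      (measurable_const_smul t), Measure.map_addHaar_smul ν ht.ne', lintegral_smul_measure,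
    lintegral_add_left_eq_self f x₀, abs_of_pos (by positivity), Real.rpow_neg ht.le,
    Real.rpow_natCast, smul_eq_mul]

theorem setLIntegral_ball_comp_homothety_le {f : E → ℝ≥0∞} (hf : Measurable f) (x₀ : E) (d : ℝ)
    {t : ℝ} (ht : t ∈ Ioo (0 : ℝ) 1) :
    ∫⁻ x in Metric.ball x₀ d, f (x₀ + t • (x - x₀)) ∂ν ≤
      ENNReal.ofReal (t ^ (-(finrank ℝ E : ℝ))) * ∫⁻ x in Metric.ball x₀ d, f x ∂ν := by
  rw [← lintegral_indicator Metric.isOpen_ball.measurableSet f,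
    ← lintegral_comp_homothety ν (hf.indicator Metric.isOpen_ball.measurableSet) x₀ ht.1,
    ← lintegral_indicator Metric.isOpen_ball.measurableSet]
  refine lintegral_mono fun x ↦ ?_
  by_cases hx : x ∈ Metric.ball x₀ d
  swap
  · simp [indicator_of_notMem hx]
  rw [indicator_of_mem hx, indicator_of_mem]
  rw [mem_ball_iff_norm] at hx ⊢
  rw [add_sub_cancel_left, norm_smul, Real.norm_of_nonneg ht.1.le]
  exact (mul_le_of_le_one_left (norm_nonneg _) ht.2.le).trans_lt hx

/-- A Poincaré–Morrey inequality on balls, for exponents larger than the dimension. -/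
theorem ContDiff.setLIntegral_ball_enorm_sub_rpow_le {F : Type*} [NormedAddCommGroup F]
    [NormedSpace ℝ F] {u : E → F} (hu : ContDiff ℝ 1 u) {r : ℝ} (hr : 1 < r)
    (hE : finrank ℝ E < r) (x₀ : E) (d : ℝ) :
    ∫⁻ x in Metric.ball x₀ d, ‖u x - u x₀‖ₑ ^ r ∂ν ≤
      (ENNReal.ofReal (r / (r - finrank ℝ E)) * ENNReal.ofReal d) ^ r *
        ∫⁻ x in Metric.ball x₀ d, ‖fderiv ℝ u x‖ₑ ^ r ∂ν := by
  have hr₀ : 0 < r := by positivity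
  set n : ℝ := (finrank ℝ E : ℝ)
  have hs : n / r < 1 := (div_lt_one hr₀).2 hE
  have hK : 1 / (1 - n / r) = r / (r - n) := by
    rw [one_sub_div hr₀.ne', one_div_div]
  set K := ENNReal.ofReal (r / (r - n)) with hK_def
  have hK₀ : K ≠ 0 := by
    simpa [hK_def] using div_pos hr₀ (sub_pos.2 hE)
  set D := ENNReal.ofReal d
  set G := ∫⁻ x in Metric.ball x₀ d, ‖fderiv ℝ u x‖ₑ ^ r ∂ν
  have hcont : Continuous (fderiv ℝ u) := hu.continuous_fderiv one_ne_zero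
  have hmeas : Measurable fun x ↦ ‖fderiv ℝ u x‖ₑ ^ r := hcont.enorm.measurable.pow_const r
  let w (t : ℝ) : ℝ≥0∞ := ENNReal.ofReal (t ^ (n / r * (r - 1)))
  have hw : Measurable w := (measurable_id.pow_const _).ennreal_ofReal
  have hpoint (x : E) (hx : x ∈ Metric.ball x₀ d) : ‖u x - u x₀‖ₑ ^ r ≤ D ^ r * K ^ (r - 1) *
      ∫⁻ t in Ioo (0 : ℝ) 1, w t * ‖fderiv ℝ u (x₀ + t • (x - x₀))‖ₑ ^ r := by
    have hxd : ‖x - x₀‖ₑ ≤ D := by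
      rw [← ofReal_norm]
      exact ENNReal.ofReal_le_ofReal (mem_ball_iff_norm.1 hx).le
    have hline : Measurable fun t : ℝ ↦ ‖fderiv ℝ u (x₀ + t • (x - x₀))‖ₑ :=
      (hcont.comp (by fun_prop)).enorm.measurable
    calc ‖u x - u x₀‖ₑ ^ r
        ≤ (D * ∫⁻ t in Ioo (0 : ℝ) 1, ‖fderiv ℝ u (x₀ + t • (x - x₀))‖ₑ) ^ r := by
          refine ENNReal.rpow_le_rpow ?_ hr₀.le
          exact (hu.enorm_sub_le_mul_lintegral_enorm_fderiv x₀ x).trans (by gcongr)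
      _ ≤ _ := by
          rw [ENNReal.mul_rpow_of_nonneg _ _ hr₀.le, mul_assoc]
          gcongr
          simpa only [hK] using lintegral_Ioo_zero_one_rpow_le hr hs hline
  have hprod : Measurable (Function.uncurry fun (x : E) (t : ℝ) ↦
      w t * ‖fderiv ℝ u (x₀ + t • (x - x₀))‖ₑ ^ r) :=
    (hw.comp measurable_snd).mul
      (hmeas.comp (g := fun x ↦ ‖fderiv ℝ u x‖ₑ ^ r)
        (f := fun p : E × ℝ ↦ x₀ + p.2 • (p.1 - x₀))
        (Continuous.measurable (by fun_prop)))
  calc ∫⁻ x in Metric.ball x₀ d, ‖u x - u x₀‖ₑ ^ r ∂ν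
      ≤ ∫⁻ x in Metric.ball x₀ d, D ^ r * K ^ (r - 1) *
          (∫⁻ t in Ioo (0 : ℝ) 1, w t * ‖fderiv ℝ u (x₀ + t • (x - x₀))‖ₑ ^ r) ∂ν :=
        setLIntegral_mono' Metric.isOpen_ball.measurableSet hpoint
    _ = D ^ r * K ^ (r - 1) * ∫⁻ t in Ioo (0 : ℝ) 1,
          w t * ∫⁻ x in Metric.ball x₀ d, ‖fderiv ℝ u (x₀ + t • (x - x₀))‖ₑ ^ r ∂ν := by
        have hC : D ^ r * K ^ (r - 1) ≠ ∞ := ENNReal.mul_ne_top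
          (ENNReal.rpow_ne_top_of_nonneg hr₀.le ENNReal.ofReal_ne_top)
          (ENNReal.rpow_ne_top_of_nonneg (sub_nonneg.2 hr.le) ENNReal.ofReal_ne_top)
        rw [lintegral_const_mul' _ _ hC,
          lintegral_lintegral_swap hprod.aemeasurable]
        congr 1
        refine lintegral_congr fun t ↦ ?_
        rw [lintegral_const_mul' _ _ ENNReal.ofReal_ne_top]
    _ ≤ D ^ r * K ^ (r - 1) * ∫⁻ t in Ioo (0 : ℝ) 1, ENNReal.ofReal (t ^ (-(n / r))) * G := by
        gcongr _ * ?_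
        refine setLIntegral_mono' measurableSet_Ioo fun t ht ↦ ?_
        refine (mul_le_mul_right (setLIntegral_ball_comp_homothety_le ν hmeas x₀ d ht) _).trans_eq ?_
        rw [← mul_assoc, ← ENNReal.ofReal_mul (Real.rpow_nonneg ht.1.le _), ← Real.rpow_add ht.1]
        congr 4
        change n / r * (r - 1) + -n = _
        field_simp
        ring
    _ = (K * D) ^ r * G := by
        rw [lintegral_mul_const _ (measurable_id'.pow_const _).ennreal_ofReal,
          lintegral_Ioo_zero_one_rpow_neg hs, hK, ENNReal.mul_rpow_of_nonneg _ _ hr₀.le,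
          ← hK_def, ← mul_assoc, mul_assoc (D ^ r), mul_comm (D ^ r)]
        congr 2
        nth_rw 2 [← ENNReal.rpow_one K]
        rw [← ENNReal.rpow_add _ _ hK₀ ENNReal.ofReal_ne_top, sub_add_cancel]

end Haar

open MeasureTheory

/-- Poincaré-type inequality: let `N ≥ 1`, `r > N`, `μ : ℝ^N → ℝ` be `C¹`,
`x₀ ∈ ℝ^N` and `d > 0`. Then
`(∫_{B_d(x₀)} |μ(x) − μ(x₀)|^r dx)^{1/r}
  ≤ (r/(r−N)) d (∫_{B_d(x₀)} ‖∇μ(x)‖^r dx)^{1/r}`,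
where `‖∇μ(x)‖` is the (operator = Euclidean) norm of the derivative of `μ` at `x`. -/
theorem statement16 (N : ℕ) (hN : 1 ≤ N) (r : ℝ) (hr : (N : ℝ) < r)
    (μ : EuclideanSpace ℝ (Fin N) → ℝ) (hμ : ContDiff ℝ 1 μ)
    (x₀ : EuclideanSpace ℝ (Fin N)) (d : ℝ) (hd : 0 < d) :
    (∫ x in Metric.ball x₀ d, |μ x - μ x₀| ^ r) ^ (1 / r) ≤
      (r / (r - N)) * d * (∫ x in Metric.ball x₀ d, ‖fderiv ℝ μ x‖ ^ r) ^ (1 / r) := by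
  have hr₁ : 1 < r := lt_of_le_of_lt (by exact_mod_cast hN) hr
  have hr₀ : 0 < r := by positivity
  have hrN : 0 < r / (r - N) := div_pos hr₀ (sub_pos.2 hr)
  have hcont : Continuous fun x ↦ ‖fderiv ℝ μ x‖ := (hμ.continuous_fderiv one_ne_zero).norm
  have hμc : Continuous μ := hμ.continuous
  have hpow {f : EuclideanSpace ℝ (Fin N) → ℝ} (hf : Continuous f) :
      Continuous fun x ↦ f x ^ r := hf.rpow_const fun _ ↦ Or.inr hr₀.le
  have hint : IntegrableOn (fun x ↦ ‖fderiv ℝ μ x‖ ^ r) (Metric.ball x₀ d) :=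
    ((hpow hcont).continuousOn.integrableOn_compact
      (isCompact_closedBall x₀ d)).mono_set Metric.ball_subset_closedBall
  have h := hμ.setLIntegral_ball_enorm_sub_rpow_le volume hr₁ (by simpa using hr) x₀ d
  have he {F : Type} [NormedAddCommGroup F] (y : F) : ‖y‖ₑ ^ r = ENNReal.ofReal (‖y‖ ^ r) := by
    rw [← ofReal_norm, ENNReal.ofReal_rpow_of_nonneg (norm_nonneg _) hr₀.le]
  have hG₀ : 0 ≤ ∫ x in Metric.ball x₀ d, ‖fderiv ℝ μ x‖ ^ r := by positivity
  have hle : ∫ x in Metric.ball x₀ d, |μ x - μ x₀| ^ r ≤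
      (r / (r - N) * d) ^ r * ∫ x in Metric.ball x₀ d, ‖fderiv ℝ μ x‖ ^ r := by
    rw [integral_eq_lintegral_of_nonneg_ae (.of_forall fun x ↦ by positivity)
      (hpow (by fun_prop)).aestronglyMeasurable]
    refine ENNReal.toReal_le_of_le_ofReal (by positivity) ?_
    rw [ENNReal.ofReal_mul (by positivity),
      ofReal_integral_eq_lintegral_ofReal hint (.of_forall fun x ↦ by positivity),
      ← ENNReal.ofReal_rpow_of_nonneg (by positivity) hr₀.le, ENNReal.ofReal_mul hrN.le]
    simpa only [he, Real.norm_eq_abs, finrank_euclideanSpace_fin] using h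
  refine (Real.rpow_le_rpow (by positivity) hle (by positivity)).trans_eq ?_
  rw [Real.mul_rpow (by positivity) hG₀, ← Real.rpow_mul (by positivity),
    mul_one_div_cancel hr₀.ne', Real.rpow_one]
end

section
/- Let N ≥ 2 be an integer and let g : ℝ^N → ℂ be a Schwartz function, with Fourier transform ĝ(ξ) = ∫_{ℝ^N} e^{−i x·ξ} g(x) dx. For j = 1,…,N define V_j : ℝ^N → ℂ by V_j(x) = −(2π)^{−N} ∫_{ℝ^N} e^{i x·ξ} (i ξ_j / |ξ|²) ĝ(ξ) dξ (the integral is absolutely convergent since N ≥ 2). Then each V_j is differentiable on ℝ^N and Σ_{j=1}^N ∂V_j/∂x_j (x) = g(x) for every x ∈ ℝ^N. -/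
open scoped BigOperators SchwartzMap
open MeasureTheory Complex
open scoped FourierTransform InnerProductSpace

section FourierHelpers

variable {E : Type*} [NormedAddCommGroup E] [InnerProductSpace ℝ E]

lemma norm_mul_inner_div_norm_sq_le (e ξ : E) (z : ℂ) :
    ‖I * ((⟪ξ, e⟫_ℝ : ℝ) : ℂ) / ((‖ξ‖ ^ 2 : ℝ) : ℂ) * z‖ ≤ ‖e‖ * ‖ξ‖⁻¹ * ‖z‖ := by
  rw [norm_mul, norm_div, norm_mul, norm_I, one_mul, norm_real, norm_real,
    Real.norm_of_nonneg (sq_nonneg ‖ξ‖)]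
  gcongr
  rcases eq_or_ne ξ 0 with rfl | h
  · simp
  have h0 : 0 < ‖ξ‖ := norm_pos_iff.2 h
  rw [div_le_iff₀ (by positivity)]
  calc ‖⟪ξ, e⟫_ℝ‖ ≤ ‖ξ‖ * ‖e‖ := norm_inner_le_norm _ _
    _ = _ := by field_simp

/-- The bilinear pairing which normalizes `VectorFourier.fourierIntegral` to have kernel
`exp (i x·ξ)`. -/
noncomputable def angularPairing (E : Type*) [NormedAddCommGroup E]
    [InnerProductSpace ℝ E] : E →L[ℝ] E →L[ℝ] ℝ :=
  -(2 * Real.pi)⁻¹ • innerSL ℝ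

lemma angularPairing_apply (ξ x : E) :
    angularPairing E ξ x = -(2 * Real.pi)⁻¹ * ⟪ξ, x⟫_ℝ := rfl

lemma fourierChar_neg_angularPairing (ξ x : E) :
    (Real.fourierChar (-angularPairing E ξ x) : ℂ) = exp (I * (⟪ξ, x⟫_ℝ : ℂ)) := by
  rw [Real.fourierChar_apply]
  congr 1
  rw [angularPairing_apply]
  push_cast
  field_simp

variable [FiniteDimensional ℝ E] [MeasurableSpace E] [BorelSpace E]

/-- Dividing a bounded integrable function by the norm preserves integrability in dimension at
least two. -/
lemma integrable_inv_norm_mul_norm (hE : 2 ≤ Module.finrank ℝ E) {f : E → ℂ}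
    (hf : Integrable f) {C : ℝ} (hC : ∀ ξ, ‖f ξ‖ ≤ C) :
    Integrable fun ξ ↦ ‖ξ‖⁻¹ * ‖f ξ‖ := by
  have hm : AEStronglyMeasurable (fun ξ : E ↦ ‖ξ‖⁻¹ * ‖f ξ‖) :=
    (measurable_norm.inv.aestronglyMeasurable).mul hf.aestronglyMeasurable.norm
  rw [← integrableOn_univ, ← Set.union_compl_self (Metric.ball (0 : E) 1)]
  refine IntegrableOn.union ?_ ?_
  · refine integrableOn_ball_of_norm_le_rpow (C := C) (α := 1) (by lia) ?_ ?_ hm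
    · exact_mod_cast hE
    · refine .of_forall fun ξ ↦ ?_
      rw [Real.rpow_neg_one, norm_mul, norm_inv, norm_norm, norm_norm, mul_comm]
      gcongr
      exact hC ξ
  · refine (hf.norm.integrableOn (s := (Metric.ball (0 : E) 1)ᶜ)).mono' hm.restrict ?_
    filter_upwards [ae_restrict_mem Metric.isOpen_ball.measurableSet.compl] with ξ hξ
    have h1 : 1 ≤ ‖ξ‖ := by simpa using hξ
    rw [norm_mul, norm_inv, norm_norm, norm_norm]
    exact mul_le_of_le_one_left (norm_nonneg _) (inv_le_one_of_one_le₀ h1)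

lemma fourierIntegral_angularPairing (f : E → ℂ) :
    VectorFourier.fourierIntegral 𝐞 volume (angularPairing E).toLinearMap₁₂ f =
      fun x ↦ ∫ ξ, exp (I * (⟪ξ, x⟫_ℝ : ℂ)) * f ξ := by
  ext x
  simp only [VectorFourier.fourierIntegral, Circle.smul_def]
  congr with ξ
  erw [fourierChar_neg_angularPairing, smul_eq_mul]

lemma differentiable_integral_exp_inner_mul {f : E → ℂ} (hf : Integrable f)
    (hf' : Integrable fun ξ ↦ ‖ξ‖ * ‖f ξ‖) :
    Differentiable ℝ fun x ↦ ∫ ξ, exp (I * (⟪ξ, x⟫_ℝ : ℂ)) * f ξ := by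
  rw [← fourierIntegral_angularPairing]
  exact VectorFourier.differentiable_fourierIntegral _ hf hf'

lemma fderiv_integral_exp_inner_mul_apply {f : E → ℂ} (hf : Integrable f)
    (hf' : Integrable fun ξ ↦ ‖ξ‖ * ‖f ξ‖) (x e : E) :
    fderiv ℝ (fun x ↦ ∫ ξ, exp (I * (⟪ξ, x⟫_ℝ : ℂ)) * f ξ) x e =
      ∫ ξ, exp (I * (⟪ξ, x⟫_ℝ : ℂ)) * (I * (⟪ξ, e⟫_ℝ : ℂ) * f ξ) := by
  have hs : Integrable (VectorFourier.fourierSMulRight (angularPairing E) f) := by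
    refine (hf'.const_mul (2 * Real.pi * ‖angularPairing E‖)).mono'
      hf.aestronglyMeasurable.fourierSMulRight (.of_forall fun ξ ↦ ?_)
    rw [← mul_assoc]
    exact VectorFourier.norm_fourierSMulRight_le _ _ _
  rw [← fourierIntegral_angularPairing, VectorFourier.fderiv_fourierIntegral _ hf hf',
    Real.fourierIntegral_continuousLinearMap_apply' hs, fourierIntegral_angularPairing]
  refine integral_congr_ae (.of_forall fun ξ ↦ congrArg _ ?_)
  simp only [VectorFourier.fourierSMulRight_apply, angularPairing_apply, real_smul, smul_eq_mul]
  push_cast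
  field_simp

/-- Fourier inversion for Schwartz functions with the angular-frequency normalization. -/
lemma SchwartzMap.integral_exp_inner_mul_fourier (g : 𝓢(E, ℂ)) (x : E) :
    ∫ ξ, exp (I * (⟪ξ, x⟫_ℝ : ℂ)) * 𝓕 g ((2 * Real.pi)⁻¹ • ξ) =
      (((2 * Real.pi) ^ Module.finrank ℝ E : ℝ) : ℂ) * g x := by
  have hinv : g x = ∫ η, exp (((2 * Real.pi * ⟪η, x⟫_ℝ : ℝ) : ℂ) * I) * 𝓕 g η := by
    conv_lhs => rw [← FourierTransform.fourierInv_fourier_eq (F := 𝓢(E, ℂ)) g]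
    rw [SchwartzMap.fourierInv_coe, Real.fourierInv_eq']
    simp only [smul_eq_mul]
  rw [hinv, ← real_smul, ← Measure.integral_comp_inv_smul_of_nonneg _ _ (by positivity)]
  congr with ξ
  rw [real_inner_smul_left]
  congr 2
  push_cast
  field_simp

lemma integral_exp_neg_inner_mul (g : 𝓢(E, ℂ)) (ξ : E) :
    ∫ x, exp (-I * (⟪ξ, x⟫_ℝ : ℂ)) * g x = 𝓕 g ((2 * Real.pi)⁻¹ • ξ) := by
  rw [SchwartzMap.fourier_coe, Real.fourier_eq']
  congr with x
  rw [real_inner_smul_right, real_inner_comm, smul_eq_mul]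
  congr 2
  push_cast
  field_simp

end FourierHelpers

/-- solution of the divergence equation in ℝ^N: let `N ≥ 2`,
`g : ℝ^N → ℂ` be Schwartz with Fourier transform `ĝ(ξ) = ∫ e^{−i x·ξ} g(x) dx`, and for
`j = 1,…,N` let `V_j(x) = −(2π)^{−N} ∫ e^{i x·ξ} (i ξ_j/|ξ|²) ĝ(ξ) dξ`. Then each `V_j` is
differentiable and `Σ_j ∂V_j/∂x_j = g` on `ℝ^N`. -/
theorem statement17 (N : ℕ) (hN : 2 ≤ N)
    (g : SchwartzMap (EuclideanSpace ℝ (Fin N)) ℂ)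
    (ghat : EuclideanSpace ℝ (Fin N) → ℂ)
    (hghat : ∀ ξ : EuclideanSpace ℝ (Fin N),
      ghat ξ = ∫ x : EuclideanSpace ℝ (Fin N),
        Complex.exp (-Complex.I * ((∑ k, x k * ξ k : ℝ) : ℂ)) * g x)
    (V : Fin N → EuclideanSpace ℝ (Fin N) → ℂ)
    (hV : ∀ (j : Fin N) (x : EuclideanSpace ℝ (Fin N)),
      V j x = -((((2 * Real.pi) ^ N : ℝ) : ℂ))⁻¹ *
        ∫ ξ : EuclideanSpace ℝ (Fin N),
          Complex.exp (Complex.I * ((∑ k, x k * ξ k : ℝ) : ℂ)) *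
            (Complex.I * (ξ j : ℂ) / ((∑ k, ξ k ^ 2 : ℝ) : ℂ)) * ghat ξ) :
    (∀ j, Differentiable ℝ (V j)) ∧
    ∀ x : EuclideanSpace ℝ (Fin N),
      (∑ j, fderiv ℝ (V j) x (EuclideanSpace.single j (1 : ℝ))) = g x := by
  have hinner (x ξ : EuclideanSpace ℝ (Fin N)) : ∑ k, x k * ξ k = ⟪ξ, x⟫_ℝ := by
    simp [PiLp.inner_apply]
  have hsq (ξ : EuclideanSpace ℝ (Fin N)) : ∑ k, ξ k ^ 2 = ‖ξ‖ ^ 2 :=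
    (EuclideanSpace.real_norm_sq_eq ξ).symm
  have hcoord (ξ : EuclideanSpace ℝ (Fin N)) (j : Fin N) :
      ⟪ξ, EuclideanSpace.single j (1 : ℝ)⟫_ℝ = ξ j := by
    simp [EuclideanSpace.inner_single_right]
  have hrank : Module.finrank ℝ (EuclideanSpace ℝ (Fin N)) = N := by simp
  have hghat' : ghat = fun ξ ↦ 𝓕 g ((2 * Real.pi)⁻¹ • ξ) := by
    ext ξ
    simp_rw [hghat, ← integral_exp_neg_inner_mul, hinner]
  have hpi : (2 * Real.pi)⁻¹ ≠ 0 := by positivity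
  have hint : Integrable ghat := by
    rw [hghat']
    exact (𝓕 g).integrable.comp_smul hpi
  obtain ⟨C, hC⟩ : ∃ C, ∀ ξ, ‖ghat ξ‖ ≤ C := by
    obtain ⟨C, -, hC⟩ := (𝓕 g).decay 0 0
    refine ⟨C, fun ξ ↦ ?_⟩
    rw [hghat']
    simpa using hC ((2 * Real.pi)⁻¹ • ξ)
  set f : Fin N → EuclideanSpace ℝ (Fin N) → ℂ :=
    fun j ξ ↦ I * (ξ j : ℂ) / ((‖ξ‖ ^ 2 : ℝ) : ℂ) * ghat ξ with hf_def
  have hbound (j : Fin N) (ξ : EuclideanSpace ℝ (Fin N)) :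
      ‖f j ξ‖ ≤ ‖ξ‖⁻¹ * ‖ghat ξ‖ := by
    have h := norm_mul_inner_div_norm_sq_le (EuclideanSpace.single j (1 : ℝ)) ξ (ghat ξ)
    rwa [hcoord, PiLp.norm_single, norm_one, one_mul] at h
  have hf_meas (j : Fin N) : AEStronglyMeasurable (f j) := by
    refine AEStronglyMeasurable.mul (Measurable.aestronglyMeasurable ?_) hint.aestronglyMeasurable
    fun_prop
  have hf_int (j : Fin N) : Integrable (f j) :=
    (integrable_inv_norm_mul_norm (by rwa [hrank]) hint hC).mono' (hf_meas j)
      (.of_forall (hbound j))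
  have hf_int' (j : Fin N) : Integrable fun ξ ↦ ‖ξ‖ * ‖f j ξ‖ := by
    refine hint.norm.mono' (continuous_norm.aestronglyMeasurable.mul (hf_meas j).norm)
      (.of_forall fun ξ ↦ ?_)
    rw [norm_mul, norm_norm, norm_norm]
    calc ‖ξ‖ * ‖f j ξ‖ ≤ ‖ξ‖ * (‖ξ‖⁻¹ * ‖ghat ξ‖) := by gcongr; exact hbound j ξ
      _ = (‖ξ‖ * ‖ξ‖⁻¹) * ‖ghat ξ‖ := by ring
      _ ≤ ‖ghat ξ‖ := mul_le_of_le_one_left (norm_nonneg _) mul_inv_le_one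
  have hV' (j : Fin N) : V j = fun x ↦ -((((2 * Real.pi) ^ N : ℝ) : ℂ))⁻¹ *
      ∫ ξ, exp (I * (⟪ξ, x⟫_ℝ : ℂ)) * f j ξ := by
    ext x
    simp_rw [hV, hinner, hsq, hf_def, mul_assoc]
  have hdiff (j : Fin N) := differentiable_integral_exp_inner_mul (hf_int j) (hf_int' j)
  refine ⟨fun j ↦ ?_, fun x ↦ ?_⟩
  · rw [hV']
    exact (hdiff j).const_mul _
  have hderiv (j : Fin N) : fderiv ℝ (V j) x (EuclideanSpace.single j (1 : ℝ)) =
      -((((2 * Real.pi) ^ N : ℝ) : ℂ))⁻¹ *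
        ∫ ξ, exp (I * (⟪ξ, x⟫_ℝ : ℂ)) * (I * (ξ j : ℂ) * f j ξ) := by
    rw [hV', fderiv_const_mul (hdiff j x), smul_apply,
      fderiv_integral_exp_inner_mul_apply (hf_int j) (hf_int' j), smul_eq_mul]
    simp_rw [hcoord]
  have hterm (j : Fin N) :
      Integrable fun ξ ↦ exp (I * (⟪ξ, x⟫_ℝ : ℂ)) * (I * (ξ j : ℂ) * f j ξ) := by
    refine (hf_int' j).mono' (AEStronglyMeasurable.mul (Measurable.aestronglyMeasurable ?_)
      (AEStronglyMeasurable.mul (Measurable.aestronglyMeasurable ?_) (hf_meas j)))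
      (.of_forall fun ξ ↦ ?_)
    · fun_prop
    · fun_prop
    · rw [norm_mul, norm_mul, norm_mul, norm_exp_I_mul_ofReal, norm_I, one_mul, one_mul, norm_real]
      gcongr
      exact PiLp.norm_apply_le ξ j
  have : Nonempty (Fin N) := ⟨⟨0, by lia⟩⟩
  have hsum : ∑ j, ∫ ξ, exp (I * (⟪ξ, x⟫_ℝ : ℂ)) * (I * (ξ j : ℂ) * f j ξ) =
      -∫ ξ, exp (I * (⟪ξ, x⟫_ℝ : ℂ)) * ghat ξ := by
    rw [← integral_finsetSum _ fun j _ ↦ hterm j, ← integral_neg]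
    refine integral_congr_ae ?_
    filter_upwards [Measure.ae_ne volume (0 : EuclideanSpace ℝ (Fin N))] with ξ hξ
    have hne : ((‖ξ‖ ^ 2 : ℝ) : ℂ) ≠ 0 := by simpa using hξ
    have hξsq : ∑ j, (ξ j : ℂ) ^ 2 = ((‖ξ‖ ^ 2 : ℝ) : ℂ) := by
      rw [← hsq]; push_cast; rfl
    calc ∑ j, exp (I * (⟪ξ, x⟫_ℝ : ℂ)) * (I * (ξ j : ℂ) * f j ξ)
        = ∑ j, (ξ j : ℂ) ^ 2 *
            (-exp (I * (⟪ξ, x⟫_ℝ : ℂ)) * ghat ξ / ((‖ξ‖ ^ 2 : ℝ) : ℂ)) := by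
          refine Finset.sum_congr rfl fun j _ ↦ ?_
          simp only [hf_def]
          linear_combination (exp (I * (⟪ξ, x⟫_ℝ : ℂ)) * (ξ j : ℂ) ^ 2 * ghat ξ /
            ((‖ξ‖ ^ 2 : ℝ) : ℂ)) * I_sq
      _ = -(exp (I * (⟪ξ, x⟫_ℝ : ℂ)) * ghat ξ) := by
          rw [← Finset.sum_mul, hξsq, mul_div_cancel₀ _ hne, neg_mul]
  have hc : (((2 * Real.pi) ^ N : ℝ) : ℂ) ≠ 0 := by
    exact_mod_cast (by positivity : (2 * Real.pi) ^ N ≠ 0)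
  simp_rw [hderiv]
  rw [← Finset.mul_sum, hsum, neg_mul_neg, hghat', SchwartzMap.integral_exp_inner_mul_fourier,
    hrank, inv_mul_cancel_left₀ hc]
end

section
/- Let N ≥ 2 be an integer, let ρ > 0 and μ > 0 be real numbers, let λ ∈ ℂ with λ ∉ (−∞,0], and let f : ℝ^N → ℂ^N be a Schwartz function with componentwise Fourier transform f̂(ξ) = ∫_{ℝ^N} e^{−ix·ξ} f(x) dx. Define ψ : ℝ^N → ℂ^N and φ : ℝ^N → ℂ by ψ(x) = (2π)^{−N} ∫_{ℝ^N} e^{ix·ξ} ( f̂(ξ) − |ξ|^{−2} ⟨ξ, f̂(ξ)⟩ ξ ) / (ρλ + μ|ξ|²) dξ and φ(x) = −(2π)^{−N} ∫_{ℝ^N} e^{ix·ξ} ⟨iξ, f̂(ξ)⟩ / |ξ|² dξ, where ⟨ξ, f̂(ξ)⟩ = Σ_{j=1}^N ξ_j f̂_j(ξ) (both integrals are absolutely convergent since N ≥ 2). Then each component of ψ is twice differentiable, φ is differentiable, and for every x ∈ ℝ^N one has ρλ ψ(x) − μ Δψ(x) + ∇φ(x) = f(x) and div ψ(x) = Σ_{j=1}^N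 ∂ψ_j/∂x_j (x) = 0. -/
open scoped BigOperators
open MeasureTheory Complex

/-- The oscillatory integral `x ↦ ∫ e^{i x·ξ} g(ξ) dξ`. -/
noncomputable def oscIntegral {N : ℕ} (g : EuclideanSpace ℝ (Fin N) → ℂ)
    (x : EuclideanSpace ℝ (Fin N)) : ℂ :=
  ∫ ξ : EuclideanSpace ℝ (Fin N), Complex.exp (Complex.I * ((∑ k, x k * ξ k : ℝ) : ℂ)) * g ξ

open VectorFourier in
theorem hasFDerivAt_oscIntegral {N : ℕ} {g : EuclideanSpace ℝ (Fin N) → ℂ} (hg : Integrable g)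
    (hg' : Integrable fun ξ => ‖ξ‖ * ‖g ξ‖) (x : EuclideanSpace ℝ (Fin N)) :
    ∃ D : EuclideanSpace ℝ (Fin N) →L[ℝ] ℂ, HasFDerivAt (oscIntegral g) D x ∧
      ∀ k, D (EuclideanSpace.single k 1) = oscIntegral (fun ξ => Complex.I * (ξ k : ℂ) * g ξ) x := by
  let L : EuclideanSpace ℝ (Fin N) →L[ℝ] EuclideanSpace ℝ (Fin N) →L[ℝ] ℝ :=
    -(2 * Real.pi)⁻¹ • innerSL ℝ
  have hL (v w) : L v w = -(2 * Real.pi)⁻¹ * ∑ k, w k * v k := by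
    have h : L v w = -(2 * Real.pi)⁻¹ * inner ℝ v w := rfl
    simpa [PiLp.inner_apply] using h
  have hexp (v w) : (Real.fourierChar (-L v w) : ℂ)
      = Complex.exp (Complex.I * ((∑ k, w k * v k : ℝ) : ℂ)) := by
    rw [Real.fourierChar_apply, hL]
    congr 1
    have : (2 * Real.pi : ℂ) ≠ 0 := by simp [Real.pi_ne_zero]
    push_cast
    field_simp
  have hF : oscIntegral g = fourierIntegral Real.fourierChar volume L.toLinearMap₁₂ g := by
    ext w
    simp only [oscIntegral, fourierIntegral]
    refine integral_congr_ae (.of_forall fun v => ?_)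
    simp only [Circle.smul_def, smul_eq_mul]
    exact congrArg (· * g v) (hexp v w).symm
  refine ⟨_, hF ▸ hasFDerivAt_fourierIntegral L hg hg' x, fun k => ?_⟩
  have hint : Integrable (fourierSMulRight L g) := by
    refine (hg'.const_mul (2 * Real.pi * ‖L‖)).mono' hg.1.fourierSMulRight (.of_forall fun v => ?_)
    simpa only [mul_assoc] using norm_fourierSMulRight_le L g v
  have hint' := (fourierIntegral_convergent_iff Real.continuous_fourierChar
    (by apply L.continuous₂ : Continuous
      (fun p : EuclideanSpace ℝ (Fin N) × EuclideanSpace ℝ (Fin N) =>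
        L.toLinearMap₁₂ p.1 p.2)) x).2 hint
  rw [fourierIntegral, ContinuousLinearMap.integral_apply hint']
  refine integral_congr_ae (.of_forall fun v => ?_)
  have h := hexp v x
  have hk : L v (EuclideanSpace.single k 1) = -(2 * Real.pi)⁻¹ * v k := by
    simp [hL]
  have : (Real.pi : ℂ) ≠ 0 := by simp [Real.pi_ne_zero]
  change (Real.fourierChar (-L v x) : ℂ) *
    (-(2 * Real.pi * Complex.I) * ((L v (EuclideanSpace.single k 1) : ℂ) * g v)) = _
  rw [h, hk]
  push_cast
  field_simp

theorem differentiable_oscIntegral {N : ℕ} {g : EuclideanSpace ℝ (Fin N) → ℂ} (hg : Integrable g)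
    (hg' : Integrable fun ξ => ‖ξ‖ * ‖g ξ‖) : Differentiable ℝ (oscIntegral g) := fun x =>
  let ⟨_, hD, _⟩ := hasFDerivAt_oscIntegral hg hg' x
  hD.differentiableAt

theorem fderiv_oscIntegral_single {N : ℕ} {g : EuclideanSpace ℝ (Fin N) → ℂ} (hg : Integrable g)
    (hg' : Integrable fun ξ => ‖ξ‖ * ‖g ξ‖) (x : EuclideanSpace ℝ (Fin N)) (k : Fin N) :
    fderiv ℝ (oscIntegral g) x (EuclideanSpace.single k 1) =
      oscIntegral (fun ξ => Complex.I * (ξ k : ℂ) * g ξ) x := by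
  obtain ⟨D, hD, h⟩ := hasFDerivAt_oscIntegral hg hg' x
  rw [hD.fderiv, h]

theorem integrable_exp_mul {N : ℕ} {g : EuclideanSpace ℝ (Fin N) → ℂ} (hg : Integrable g)
    (x : EuclideanSpace ℝ (Fin N)) :
    Integrable fun ξ : EuclideanSpace ℝ (Fin N) =>
      Complex.exp (Complex.I * ((∑ k, x k * ξ k : ℝ) : ℂ)) * g ξ := by
  refine hg.norm.mono' (.mul (Continuous.aestronglyMeasurable (by fun_prop)) hg.1)
    (.of_forall fun ξ => ?_)
  rw [norm_mul, mul_comm Complex.I, Complex.norm_exp_ofReal_mul_I, one_mul]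

theorem oscIntegral_add {N : ℕ} {g h : EuclideanSpace ℝ (Fin N) → ℂ} (hg : Integrable g)
    (hh : Integrable h) (x : EuclideanSpace ℝ (Fin N)) :
    oscIntegral (fun ξ => g ξ + h ξ) x = oscIntegral g x + oscIntegral h x := by
  simp only [oscIntegral, mul_add]
  exact integral_add (integrable_exp_mul hg x) (integrable_exp_mul hh x)

theorem oscIntegral_const_mul {N : ℕ} (c : ℂ) (g : EuclideanSpace ℝ (Fin N) → ℂ)
    (x : EuclideanSpace ℝ (Fin N)) :
    oscIntegral (fun ξ => c * g ξ) x = c * oscIntegral g x := by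
  simp only [oscIntegral, mul_left_comm _ c]
  exact integral_const_mul _ _

theorem oscIntegral_sum {N : ℕ} {ι : Type*} (s : Finset ι)
    {g : ι → EuclideanSpace ℝ (Fin N) → ℂ} (hg : ∀ i ∈ s, Integrable (g i))
    (x : EuclideanSpace ℝ (Fin N)) :
    oscIntegral (fun ξ => ∑ i ∈ s, g i ξ) x = ∑ i ∈ s, oscIntegral (g i) x := by
  simp only [oscIntegral, Finset.mul_sum]
  exact integral_finsetSum _ fun i hi => integrable_exp_mul (hg i hi) x

open scoped FourierTransform in
/-- The Fourier transform with kernel `e^{-i x·ξ}` of a Schwartz function is Schwartz and satisfies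
the inversion formula. -/
theorem exists_schwartz_fourier_inversion {N : ℕ}
    (f : SchwartzMap (EuclideanSpace ℝ (Fin N)) (EuclideanSpace ℂ (Fin N))) :
    ∃ G : SchwartzMap (EuclideanSpace ℝ (Fin N)) (EuclideanSpace ℂ (Fin N)),
      (∀ ξ, G ξ = ∫ x : EuclideanSpace ℝ (Fin N),
        Complex.exp (-Complex.I * ((∑ k, x k * ξ k : ℝ) : ℂ)) • f x) ∧
      ∀ (x : EuclideanSpace ℝ (Fin N)) (j : Fin N),
        ((((2 * Real.pi) ^ N : ℝ) : ℂ))⁻¹ * oscIntegral (fun ξ => G ξ j) x = f x j := by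
  have hpi : (2 * Real.pi)⁻¹ ≠ 0 := by positivity
  let e : EuclideanSpace ℝ (Fin N) ≃L[ℝ] EuclideanSpace ℝ (Fin N) :=
    ContinuousLinearEquiv.smulLeft (Units.mk0 _ hpi)
  let G := SchwartzMap.compCLMOfContinuousLinearEquiv ℂ e (𝓕 f)
  have hG (ξ) : G ξ = 𝓕 (f : EuclideanSpace ℝ (Fin N) → _) ((2 * Real.pi)⁻¹ • ξ) := rfl
  refine ⟨G, fun ξ => ?_, fun x j => ?_⟩
  · rw [hG, Real.fourier_eq']
    refine integral_congr_ae (.of_forall fun v => ?_)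
    simp only [inner_smul_right, PiLp.inner_apply]
    congr 2
    have : (Real.pi : ℂ) ≠ 0 := by simp [Real.pi_ne_zero]
    simp only [RCLike.inner_apply, conj_trivial]
    push_cast
    field_simp
    simp only [mul_comm]
  · have hcont : Integrable (fun v : EuclideanSpace ℝ (Fin N) =>
        Complex.exp ((2 * Real.pi * inner ℝ v x : ℝ) * Complex.I) • 𝓕 f v) := by
      refine (𝓕 f).integrable.norm.mono' (Continuous.aestronglyMeasurable ?_)
        (.of_forall fun v => ?_)
      · have := (𝓕 f).continuous
        fun_prop
      · rw [norm_smul, Complex.norm_exp_ofReal_mul_I, one_mul]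
    have hinv : f x = ∫ v : EuclideanSpace ℝ (Fin N),
        Complex.exp ((2 * Real.pi * inner ℝ v x : ℝ) * Complex.I) • 𝓕 f v := by
      rw [← Real.fourierInv_eq', ← SchwartzMap.fourierInv_coe,
        FourierTransform.fourierInv_fourier_eq]
    have hj : f x j = ∫ v : EuclideanSpace ℝ (Fin N),
        Complex.exp ((2 * Real.pi * inner ℝ v x : ℝ) * Complex.I) * 𝓕 f v j := by
      have := (EuclideanSpace.proj (𝕜 := ℂ) j).integral_comp_comm hcont
      rw [hinv]
      exact this.symm
    have hscale := Measure.integral_comp_smul (volume : Measure (EuclideanSpace ℝ (Fin N)))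
      (fun v : EuclideanSpace ℝ (Fin N) =>
        Complex.exp ((2 * Real.pi * inner ℝ v x : ℝ) * Complex.I) * 𝓕 f v j) (2 * Real.pi)⁻¹
    have hosc : oscIntegral (fun ξ => G ξ j) x = ∫ v : EuclideanSpace ℝ (Fin N),
        Complex.exp ((2 * Real.pi * inner ℝ ((2 * Real.pi)⁻¹ • v) x : ℝ) * Complex.I) *
          𝓕 f ((2 * Real.pi)⁻¹ • v) j := by
      refine integral_congr_ae (.of_forall fun v => ?_)
      refine congrArg₂ (· * ·) (congrArg Complex.exp ?_) rfl
      have : (Real.pi : ℂ) ≠ 0 := by simp [Real.pi_ne_zero]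
      rw [real_inner_smul_left]
      simp only [PiLp.inner_apply, RCLike.inner_apply, conj_trivial]
      push_cast
      field_simp
    rw [hosc, hscale, ← hj, finrank_euclideanSpace_fin, inv_pow, inv_inv,
      abs_of_pos (by positivity), Complex.real_smul, ← mul_assoc, inv_mul_cancel₀, one_mul]
    exact_mod_cast (by positivity : (2 * Real.pi) ^ N ≠ 0)

theorem integrable_of_norm_le_inv_norm_mul {N : ℕ} (hN : 2 ≤ N) {F : Type*}
    [NormedAddCommGroup F] [NormedSpace ℝ F] (G : SchwartzMap (EuclideanSpace ℝ (Fin N)) F)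
    {p : EuclideanSpace ℝ (Fin N) → ℂ} (hp : AEStronglyMeasurable p) {C : ℝ} (hC : 0 ≤ C)
    (h : ∀ ξ, ‖p ξ‖ ≤ C * (‖ξ‖⁻¹ * ‖G ξ‖)) : Integrable p := by
  rw [← integrableOn_univ, ← Set.union_compl_self (Metric.ball 0 1)]
  refine IntegrableOn.union ?_ ?_
  · refine integrableOn_ball_of_norm_le_rpow (C := C * SchwartzMap.seminorm ℝ 0 0 G) (α := 1)
      (by simp; omega) (by simp; omega) (.of_forall fun ξ => (h ξ).trans ?_) hp
    rw [Real.rpow_neg_one, mul_assoc, mul_comm (‖ξ‖⁻¹)]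
    gcongr
    exact G.norm_le_seminorm ℝ ξ
  · refine ((G.integrable.norm.const_mul C).integrableOn).mono' hp.restrict ?_
    filter_upwards [ae_restrict_mem Metric.isOpen_ball.measurableSet.compl] with ξ hξ
    have h1 : 1 ≤ ‖ξ‖ := by simpa using hξ
    refine (h ξ).trans ?_
    gcongr
    exact mul_le_of_le_one_left (norm_nonneg _) (inv_le_one_of_one_le₀ h1)

theorem integrable_of_norm_le_norm_pow_mul {N : ℕ} {F E : Type*}
    [NormedAddCommGroup F] [NormedSpace ℝ F] [NormedAddCommGroup E]
    (G : SchwartzMap (EuclideanSpace ℝ (Fin N)) F)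
    {p : EuclideanSpace ℝ (Fin N) → E} (hp : AEStronglyMeasurable p) (n : ℕ) {C : ℝ}
    (h : ∀ ξ, ‖p ξ‖ ≤ C * (‖ξ‖ ^ n * ‖G ξ‖)) : Integrable p :=
  ((G.integrable_pow_mul volume n).const_mul C).mono' hp (.of_forall h)

theorem integrable_norm_mul_of_norm_le_norm_pow_mul {N : ℕ} {F E : Type*}
    [NormedAddCommGroup F] [NormedSpace ℝ F] [NormedAddCommGroup E]
    (G : SchwartzMap (EuclideanSpace ℝ (Fin N)) F)
    {p : EuclideanSpace ℝ (Fin N) → E} (hp : AEStronglyMeasurable p) (n : ℕ) {C : ℝ}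
    (h : ∀ ξ, ‖p ξ‖ ≤ C * (‖ξ‖ ^ n * ‖G ξ‖)) : Integrable fun ξ => ‖ξ‖ * ‖p ξ‖ := by
  refine integrable_of_norm_le_norm_pow_mul G (.mul (by fun_prop) hp.norm) (n + 1) (C := C)
    fun ξ => ?_
  rw [norm_mul, norm_norm, norm_norm]
  calc ‖ξ‖ * ‖p ξ‖ ≤ ‖ξ‖ * (C * (‖ξ‖ ^ n * ‖G ξ‖)) := by gcongr; exact h ξ
    _ = _ := by ring

theorem exists_pos_le_norm_resolvent_symbol {ρ μ : ℝ} (hρ : 0 < ρ) (hμ : 0 < μ) {l : ℂ}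
    (hl : ∀ t : ℝ, t ≤ 0 → l ≠ (t : ℂ)) :
    ∃ c : ℝ, 0 < c ∧ ∀ t : ℝ, 0 ≤ t → c ≤ ‖(ρ : ℂ) * l + (μ : ℂ) * (t : ℂ)‖ := by
  by_cases him : l.im = 0
  · have hre : 0 < l.re := by
      by_contra! hre
      exact hl l.re hre (Complex.ext rfl (by simpa using him))
    refine ⟨ρ * l.re, by positivity, fun t ht => le_trans ?_ (Complex.re_le_norm _)⟩
    simp
    positivity
  · refine ⟨ρ * |l.im|, by positivity, fun t _ => le_trans ?_ (Complex.abs_im_le_norm _)⟩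
    simp [abs_mul, abs_of_pos hρ]

theorem norm_I_mul_coord_mul_le {N : ℕ} (ξ : EuclideanSpace ℝ (Fin N)) (k : Fin N) (z : ℂ) :
    ‖Complex.I * (ξ k : ℂ) * z‖ ≤ ‖ξ‖ * ‖z‖ := by
  rw [norm_mul, norm_mul, Complex.norm_I, one_mul, Complex.norm_real]
  gcongr
  exact PiLp.norm_apply_le ξ k

theorem norm_sum_coord_mul_le {N : ℕ} (ξ : EuclideanSpace ℝ (Fin N))
    (v : EuclideanSpace ℂ (Fin N)) : ‖∑ k, (ξ k : ℂ) * v k‖ ≤ N * (‖ξ‖ * ‖v‖) := by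
  refine (norm_sum_le_of_le (f := fun k => (ξ k : ℂ) * v k) _ fun k _ => ?_).trans_eq
    (b := ∑ _k : Fin N, ‖ξ‖ * ‖v‖) (by simp)
  rw [norm_mul, Complex.norm_real]
  gcongr
  · exact PiLp.norm_apply_le ξ k
  · exact PiLp.norm_apply_le v k

theorem norm_leray_symbol_le {N : ℕ} (ξ : EuclideanSpace ℝ (Fin N))
    (v : EuclideanSpace ℂ (Fin N)) (j : Fin N) :
    ‖v j - (((∑ k, ξ k ^ 2 : ℝ) : ℂ))⁻¹ * (∑ k, (ξ k : ℂ) * v k) * (ξ j : ℂ)‖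
      ≤ (1 + N) * ‖v‖ := by
  rw [← EuclideanSpace.real_norm_sq_eq, add_mul, one_mul]
  refine (norm_sub_le _ _).trans <| add_le_add (PiLp.norm_apply_le v j) ?_
  rcases eq_or_ne ξ 0 with rfl | h
  · simp; positivity
  have h0 : ‖ξ‖ ≠ 0 := norm_ne_zero_iff.2 h
  rw [norm_mul, norm_mul, norm_inv, Complex.norm_real, Complex.norm_real, norm_pow, norm_norm]
  calc (‖ξ‖ ^ 2)⁻¹ * ‖∑ k, (ξ k : ℂ) * v k‖ * ‖ξ j‖
      ≤ (‖ξ‖ ^ 2)⁻¹ * (N * (‖ξ‖ * ‖v‖)) * ‖ξ‖ := by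
        gcongr
        · exact norm_sum_coord_mul_le ξ v
        · exact PiLp.norm_apply_le ξ j
    _ = _ := by field_simp

theorem norm_pressure_symbol_le {N : ℕ} (ξ : EuclideanSpace ℝ (Fin N))
    (v : EuclideanSpace ℂ (Fin N)) :
    ‖(∑ k, Complex.I * (ξ k : ℂ) * v k) / ((∑ k, ξ k ^ 2 : ℝ) : ℂ)‖ ≤ N * (‖ξ‖⁻¹ * ‖v‖) := by
  rw [← EuclideanSpace.real_norm_sq_eq]
  rcases eq_or_ne ξ 0 with rfl | h
  · simp
  have h0 : ‖ξ‖ ≠ 0 := norm_ne_zero_iff.2 h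
  simp only [mul_assoc, ← Finset.mul_sum]
  rw [norm_div, norm_mul, Complex.norm_I, one_mul, Complex.norm_real, norm_pow, norm_norm]
  calc ‖∑ k, (ξ k : ℂ) * v k‖ / ‖ξ‖ ^ 2 ≤ N * (‖ξ‖ * ‖v‖) / ‖ξ‖ ^ 2 := by
        gcongr; exact norm_sum_coord_mul_le ξ v
    _ = _ := by field_simp

/-- Stokes resolvent in the whole space: let `N ≥ 2`, `ρ, μ > 0`,
`λ ∈ ℂ ∖ (−∞,0]`, and `f : ℝ^N → ℂ^N` Schwartz with componentwise Fourier transform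
`f̂(ξ) = ∫ e^{−i x·ξ} f(x) dx`. With
`ψ(x) = (2π)^{−N} ∫ e^{i x·ξ} (f̂(ξ) − |ξ|^{−2} ⟨ξ, f̂(ξ)⟩ ξ)/(ρλ + μ|ξ|²) dξ` and
`φ(x) = −(2π)^{−N} ∫ e^{i x·ξ} ⟨iξ, f̂(ξ)⟩/|ξ|² dξ`, each component of `ψ` is twice
differentiable, `φ` is differentiable, and `ρλ ψ − μ Δψ + ∇φ = f` with `div ψ = 0`. -/
theorem statement18 (N : ℕ) (hN : 2 ≤ N) (ρ μ : ℝ) (hρ : 0 < ρ) (hμ : 0 < μ)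
    (l : ℂ) (hl : ∀ t : ℝ, t ≤ 0 → l ≠ (t : ℂ))
    (f : SchwartzMap (EuclideanSpace ℝ (Fin N)) (EuclideanSpace ℂ (Fin N)))
    (fhat : EuclideanSpace ℝ (Fin N) → EuclideanSpace ℂ (Fin N))
    (hfhat : ∀ ξ : EuclideanSpace ℝ (Fin N),
      fhat ξ = ∫ x : EuclideanSpace ℝ (Fin N),
        Complex.exp (-Complex.I * ((∑ k, x k * ξ k : ℝ) : ℂ)) • f x)
    (ψ : Fin N → EuclideanSpace ℝ (Fin N) → ℂ)
    (hψ : ∀ (j : Fin N) (x : EuclideanSpace ℝ (Fin N)),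
      ψ j x = ((((2 * Real.pi) ^ N : ℝ) : ℂ))⁻¹ *
        ∫ ξ : EuclideanSpace ℝ (Fin N),
          Complex.exp (Complex.I * ((∑ k, x k * ξ k : ℝ) : ℂ)) *
            ((fhat ξ j - (((∑ k, ξ k ^ 2 : ℝ) : ℂ))⁻¹ *
                (∑ k, (ξ k : ℂ) * fhat ξ k) * (ξ j : ℂ)) /
              ((ρ : ℂ) * l + (μ : ℂ) * ((∑ k, ξ k ^ 2 : ℝ) : ℂ))))
    (φ : EuclideanSpace ℝ (Fin N) → ℂ)
    (hφ : ∀ x : EuclideanSpace ℝ (Fin N),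
      φ x = -((((2 * Real.pi) ^ N : ℝ) : ℂ))⁻¹ *
        ∫ ξ : EuclideanSpace ℝ (Fin N),
          Complex.exp (Complex.I * ((∑ k, x k * ξ k : ℝ) : ℂ)) *
            ((∑ k, Complex.I * (ξ k : ℂ) * fhat ξ k) / ((∑ k, ξ k ^ 2 : ℝ) : ℂ))) :
    (∀ j, Differentiable ℝ (ψ j) ∧
      ∀ k, Differentiable ℝ
        (fun x => fderiv ℝ (ψ j) x (EuclideanSpace.single k (1 : ℝ)))) ∧
    Differentiable ℝ φ ∧
    (∀ (x : EuclideanSpace ℝ (Fin N)) (j : Fin N),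
      (ρ : ℂ) * l * ψ j x -
          (μ : ℂ) * (∑ k, fderiv ℝ
            (fun y => fderiv ℝ (ψ j) y (EuclideanSpace.single k (1 : ℝ))) x
            (EuclideanSpace.single k (1 : ℝ))) +
          fderiv ℝ φ x (EuclideanSpace.single j (1 : ℝ))
        = f x j) ∧
    (∀ x : EuclideanSpace ℝ (Fin N),
      (∑ j, fderiv ℝ (ψ j) x (EuclideanSpace.single j (1 : ℝ))) = 0) := by
  obtain ⟨G, hG, hinv⟩ := exists_schwartz_fourier_inversion f
  obtain rfl : fhat = G := funext fun ξ => (hfhat ξ).trans (hG ξ).symm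
  obtain ⟨c, hc, hden⟩ := exists_pos_le_norm_resolvent_symbol hρ hμ hl
  set a : ℂ := ((((2 * Real.pi) ^ N : ℝ) : ℂ))⁻¹
  let m (j : Fin N) (ξ : EuclideanSpace ℝ (Fin N)) : ℂ :=
    (G ξ j - (((∑ k, ξ k ^ 2 : ℝ) : ℂ))⁻¹ * (∑ k, (ξ k : ℂ) * G ξ k) * (ξ j : ℂ)) /
      ((ρ : ℂ) * l + (μ : ℂ) * ((∑ k, ξ k ^ 2 : ℝ) : ℂ))
  let p (ξ : EuclideanSpace ℝ (Fin N)) : ℂ :=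
    (∑ k, Complex.I * (ξ k : ℂ) * G ξ k) / ((∑ k, ξ k ^ 2 : ℝ) : ℂ)
  obtain rfl : ψ = fun j x => a * oscIntegral (m j) x := funext₂ hψ
  obtain rfl : φ = fun x => -a * oscIntegral p x := funext hφ
  have hGk (k : Fin N) : Measurable fun ξ => G ξ k :=
    Continuous.measurable (by have := G.continuous; fun_prop)
  have hm (j) : Measurable (m j) := by fun_prop
  have hp : Measurable p := by fun_prop
  have hm₁ (j k : Fin N) : Measurable fun ξ => Complex.I * (ξ k : ℂ) * m j ξ := by fun_prop
  have hm₂ (j k : Fin N) :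
      Measurable fun ξ => Complex.I * (ξ k : ℂ) * (Complex.I * (ξ k : ℂ) * m j ξ) := by fun_prop
  have hp₁ (k : Fin N) : Measurable fun ξ => Complex.I * (ξ k : ℂ) * p ξ := by fun_prop
  have bm (j) (ξ) : ‖m j ξ‖ ≤ (1 + N) / c * (‖ξ‖ ^ 0 * ‖G ξ‖) := by
    rw [norm_div, pow_zero, one_mul, div_mul_eq_mul_div]
    exact div_le_div₀ (by positivity) (norm_leray_symbol_le ξ (G ξ) j) hc
      (hden _ (Finset.sum_nonneg fun k _ => sq_nonneg _))
  have bm₁ (j k : Fin N) (ξ) :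
      ‖Complex.I * (ξ k : ℂ) * m j ξ‖ ≤ (1 + N) / c * (‖ξ‖ ^ 1 * ‖G ξ‖) := by
    grw [norm_I_mul_coord_mul_le, bm]
    exact le_of_eq (by ring)
  have bm₂ (j k : Fin N) (ξ) :
      ‖Complex.I * (ξ k : ℂ) * (Complex.I * (ξ k : ℂ) * m j ξ)‖ ≤
        (1 + N) / c * (‖ξ‖ ^ 2 * ‖G ξ‖) := by
    grw [norm_I_mul_coord_mul_le, bm₁]
    exact le_of_eq (by ring)
  have bp (ξ) : ‖p ξ‖ ≤ N * (‖ξ‖⁻¹ * ‖G ξ‖) := norm_pressure_symbol_le ξ (G ξ)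
  have bnp (ξ) : ‖ξ‖ * ‖p ξ‖ ≤ N * (‖ξ‖ ^ 0 * ‖G ξ‖) := by
    grw [bp]
    rcases eq_or_ne ‖ξ‖ 0 with h | h
    · rw [h, zero_mul]; positivity
    · exact le_of_eq (by field_simp)
  have im (j) := integrable_of_norm_le_norm_pow_mul G (hm j).aestronglyMeasurable 0 (bm j)
  have im' (j) := integrable_norm_mul_of_norm_le_norm_pow_mul G (hm j).aestronglyMeasurable 0 (bm j)
  have im₁ (j k) :=
    integrable_of_norm_le_norm_pow_mul G (hm₁ j k).aestronglyMeasurable 1 (bm₁ j k)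
  have im₁' (j k) :=
    integrable_norm_mul_of_norm_le_norm_pow_mul G (hm₁ j k).aestronglyMeasurable 1 (bm₁ j k)
  have im₂ (j k) :=
    integrable_of_norm_le_norm_pow_mul G (hm₂ j k).aestronglyMeasurable 2 (bm₂ j k)
  have ip : Integrable p :=
    integrable_of_norm_le_inv_norm_mul hN G hp.aestronglyMeasurable N.cast_nonneg bp
  have ip' : Integrable fun ξ => ‖ξ‖ * ‖p ξ‖ :=
    integrable_of_norm_le_norm_pow_mul G (by fun_prop) 0 (C := N) fun ξ => by
      rw [norm_mul, norm_norm, norm_norm]; exact bnp ξ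
  have ip₁ (k : Fin N) : Integrable fun ξ => Complex.I * (ξ k : ℂ) * p ξ :=
    integrable_of_norm_le_norm_pow_mul G (hp₁ k).aestronglyMeasurable 0 fun ξ =>
      (norm_I_mul_coord_mul_le ξ k _).trans (bnp ξ)
  have dm (j) := differentiable_oscIntegral (im j) (im' j)
  have dm₁ (j k) := differentiable_oscIntegral (im₁ j k) (im₁' j k)
  have dp := differentiable_oscIntegral ip ip'
  have fm (j k : Fin N) (x) :
      fderiv ℝ (fun x => a * oscIntegral (m j) x) x (EuclideanSpace.single k 1) =
        a * oscIntegral (fun ξ => Complex.I * (ξ k : ℂ) * m j ξ) x := by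
    rw [fderiv_const_mul (dm j x), ← fderiv_oscIntegral_single (im j) (im' j)]
    rfl
  have fm₁ (j k : Fin N) (x) :
      fderiv ℝ (fun x => a * oscIntegral (fun ξ => Complex.I * (ξ k : ℂ) * m j ξ) x) x
          (EuclideanSpace.single k 1) =
        a * oscIntegral (fun ξ => Complex.I * (ξ k : ℂ) * (Complex.I * (ξ k : ℂ) * m j ξ)) x := by
    rw [fderiv_const_mul (dm₁ j k x), ← fderiv_oscIntegral_single (im₁ j k) (im₁' j k)]
    rfl
  have fp (k : Fin N) (x) :
      fderiv ℝ (fun x => -a * oscIntegral p x) x (EuclideanSpace.single k 1) =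
        -a * oscIntegral (fun ξ => Complex.I * (ξ k : ℂ) * p ξ) x := by
    rw [fderiv_const_mul (dp x), ← fderiv_oscIntegral_single ip ip']
    rfl
  simp only [fm, fm₁, fp]
  refine ⟨fun j => ⟨(dm j).const_mul a, fun k => (dm₁ j k).const_mul a⟩, dp.const_mul (-a),
    fun x j => ?_, fun x => ?_⟩
  · have hsymbol : (fun ξ => G ξ j) = fun ξ =>
        ((ρ : ℂ) * l * m j ξ +
          -(μ : ℂ) * ∑ k, Complex.I * (ξ k : ℂ) * (Complex.I * (ξ k : ℂ) * m j ξ)) +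
        -1 * (Complex.I * (ξ j : ℂ) * p ξ) := by
      ext ξ
      have hne : (ρ : ℂ) * l + (μ : ℂ) * ((∑ k, ξ k ^ 2 : ℝ) : ℂ) ≠ 0 :=
        norm_pos_iff.1 (hc.trans_le (hden _ (Finset.sum_nonneg fun k _ => sq_nonneg _)))
      have hsum : ∑ k, Complex.I * (ξ k : ℂ) * (Complex.I * (ξ k : ℂ) * m j ξ) =
          -((∑ k, ξ k ^ 2 : ℝ) : ℂ) * m j ξ := by
        push_cast
        rw [neg_mul, Finset.sum_mul, ← Finset.sum_neg_distrib]
        refine Finset.sum_congr rfl fun k _ => ?_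
        linear_combination (ξ k : ℂ) ^ 2 * m j ξ * Complex.I_sq
      have hp' : p ξ = Complex.I * ((((∑ k, ξ k ^ 2 : ℝ) : ℂ))⁻¹ * ∑ k, (ξ k : ℂ) * G ξ k) := by
        simp only [p, mul_assoc, ← Finset.mul_sum]
        ring
      have hm' : m j ξ * ((ρ : ℂ) * l + (μ : ℂ) * ((∑ k, ξ k ^ 2 : ℝ) : ℂ)) =
          G ξ j - (((∑ k, ξ k ^ 2 : ℝ) : ℂ))⁻¹ * (∑ k, (ξ k : ℂ) * G ξ k) * (ξ j : ℂ) :=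
        div_mul_cancel₀ _ hne
      rw [hsum, hp']
      linear_combination -hm' + (((∑ k, ξ k ^ 2 : ℝ) : ℂ))⁻¹ * (∑ k, (ξ k : ℂ) * G ξ k) * (ξ j : ℂ)
        * Complex.I_sq
    have isum : Integrable fun ξ =>
        ∑ k, Complex.I * (ξ k : ℂ) * (Complex.I * (ξ k : ℂ) * m j ξ) :=
      integrable_finsetSum _ fun k _ => im₂ j k
    have iadd : Integrable fun ξ => (ρ : ℂ) * l * m j ξ +
        -(μ : ℂ) * ∑ k, Complex.I * (ξ k : ℂ) * (Complex.I * (ξ k : ℂ) * m j ξ) :=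
      ((im j).const_mul _).add (isum.const_mul _)
    rw [← hinv x j, hsymbol, oscIntegral_add iadd ((ip₁ j).const_mul _),
      oscIntegral_add ((im j).const_mul _) (isum.const_mul _), oscIntegral_const_mul,
      oscIntegral_const_mul, oscIntegral_const_mul, oscIntegral_sum _ fun k _ => im₂ j k,
      ← Finset.mul_sum]
    ring
  · rw [← Finset.mul_sum, ← oscIntegral_sum _ fun j _ => im₁ j j]
    have hdiv : (fun ξ => ∑ j, Complex.I * (ξ j : ℂ) * m j ξ) = fun _ => 0 := by
      ext ξ
      set S := ∑ k, (ξ k : ℂ) * G ξ k with hS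
      set q : ℂ := ((∑ k, ξ k ^ 2 : ℝ) : ℂ) with hq
      set d : ℂ := (ρ : ℂ) * l + (μ : ℂ) * q
      have hsum : ∑ j, Complex.I * (ξ j : ℂ) * m j ξ = Complex.I * (S - q⁻¹ * S * q) / d := by
        rw [hq, hS]
        push_cast
        rw [Finset.mul_sum _ _ ((∑ k, (ξ k : ℂ) ^ 2)⁻¹ * _), ← Finset.sum_sub_distrib,
          Finset.mul_sum, Finset.sum_div]
        refine Finset.sum_congr rfl fun j _ => ?_
        simp only [m, d, q]
        push_cast
        ring
      rw [hsum]
      rcases eq_or_ne ξ 0 with rfl | h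
      · simp [S]
      have hq0 : q ≠ 0 := by
        rw [hq, ← EuclideanSpace.real_norm_sq_eq]
        simpa using h
      field_simp
      simp
    rw [hdiv]
    simp [oscIntegral]
end
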